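/- arXiv:1508.07753 — 2 statements merged into one kernel-verified Lean document; each statement's English description precedes it below -/
import Mathlib

section
/- Let H be a group DAG on a grouping W of a finite node set N in which the maximum group size is 2 and no group of size 2 is adjacent to any other group in H. Then every distribution p on N that is groupwise faithful to H given W is faithful to some DAG on N. -/
open scoped Classical

namespace GroupBN

variable {V : Type*} {I : Type*}

/-- `u` and `v` are adjacent in the digraph with arc relation `A`. -/
def Adj (A : V → V → Prop) (u v : V) : Prop := A u v ∨ A v u

/-- `A` is the arc relation of a DAG: there are no directed cycles
(in particular `A` is irreflexive). -/
def IsDAG (A : V → V → Prop) : Prop := ∀ v : V, ¬ Relation.TransGen A v v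

/-- `u` is an ancestor of `v`: there is a nonempty directed path from `u` to `v`. -/
def Ancestor (A : V → V → Prop) (u v : V) : Prop := Relation.TransGen A u v

/-- `u` and `v` are d-connected given `Z`: there is a path (an injective sequence of
pairwise adjacent consecutive nodes) from `u` to `v` such that every head-to-head
interior node is in `Z` or has a descendant in `Z`, and no other interior node is
in `Z`. -/
def DConn (A : V → V → Prop) (Z : Set V) (u v : V) : Prop :=
  ∃ (n : ℕ) (pth : Fin (n + 2) → V),
    Function.Injective pth ∧
    pth 0 = u ∧ pth (Fin.last (n + 1)) = v ∧
    (∀ (k : ℕ) (h : k + 1 < n + 2),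
      Adj A (pth ⟨k, Nat.lt_of_succ_lt h⟩) (pth ⟨k + 1, h⟩)) ∧
    (∀ (k : ℕ) (h : k + 2 < n + 2),
      (A (pth ⟨k, by omega⟩) (pth ⟨k + 1, by omega⟩) ∧
         A (pth ⟨k + 2, h⟩) (pth ⟨k + 1, by omega⟩) →
        (pth ⟨k + 1, by omega⟩ ∈ Z ∨ ∃ d ∈ Z, Ancestor A (pth ⟨k + 1, by omega⟩) d)) ∧
      (¬ (A (pth ⟨k, by omega⟩) (pth ⟨k + 1, by omega⟩) ∧
            A (pth ⟨k + 2, h⟩) (pth ⟨k + 1, by omega⟩)) →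
        pth ⟨k + 1, by omega⟩ ∉ Z))

/-- `u` and `v` are d-separated by `Z`. -/
def DSep (A : V → V → Prop) (Z : Set V) (u v : V) : Prop := ¬ DConn A Z u v

/-- The node sets `X` and `Y` are d-separated by `Z`. -/
def DSepSet (A : V → V → Prop) (Z X Y : Set V) : Prop :=
  ∀ x ∈ X, ∀ y ∈ Y, DSep A Z x y

variable {S : V → Type*}

/-- `p` is a probability mass function on the joint state space. -/
def IsDist [Fintype V] [DecidableEq V] [∀ v, Fintype (S v)]
    (p : (∀ v, S v) → ℝ) : Prop :=
  (∀ f, 0 ≤ p f) ∧ ∑ f, p f = 1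

/-- Marginal probability, under `p`, of the event that the variables in `X` take
the values prescribed by the assignment `a`. -/
noncomputable def margin [Fintype V] [DecidableEq V] [∀ v, Fintype (S v)]
    (p : (∀ v, S v) → ℝ) (X : Set V) (a : ∀ v, S v) : ℝ :=
  ∑ f : ∀ v, S v, if ∀ v ∈ X, f v = a v then p f else 0

/-- Conditional independence `X ⊥ Y | Z` in `p`, in cross-multiplied form:
for every assignment whose `Z`-part has positive probability,
`P(X,Y,Z) · P(Z) = P(X,Z) · P(Y,Z)`. -/
def CondIndep [Fintype V] [DecidableEq V] [∀ v, Fintype (S v)]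
    (p : (∀ v, S v) → ℝ) (X Y Z : Set V) : Prop :=
  ∀ a : ∀ v, S v, 0 < margin p Z a →
    margin p (X ∪ Y ∪ Z) a * margin p Z a = margin p (X ∪ Z) a * margin p (Y ∪ Z) a

/-- `p` is faithful to the DAG `A`: conditional independence coincides with
d-separation for all pairwise disjoint `X`, `Y`, `Z` with `X`, `Y` nonempty. -/
def Faithful [Fintype V] [DecidableEq V] [∀ v, Fintype (S v)]
    (p : (∀ v, S v) → ℝ) (A : V → V → Prop) : Prop :=
  ∀ X Y Z : Set V, X.Nonempty → Y.Nonempty →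
    Disjoint X Y → Disjoint X Z → Disjoint Y Z →
    (CondIndep p X Y Z ↔ DSepSet A Z X Y)

/-- `p` is groupwise faithful to the group DAG `H` given the grouping whose groups
are the fibers of the surjection `π`. -/
def GroupwiseFaithful [Fintype V] [DecidableEq V] [∀ v, Fintype (S v)]
    (p : (∀ v, S v) → ℝ) (π : V → I) (H : I → I → Prop) : Prop :=
  ∀ i j : I, i ≠ j → ∀ T : Set I, i ∉ T → j ∉ T →
    (CondIndep p (π ⁻¹' {i}) (π ⁻¹' {j}) (π ⁻¹' T) ↔ DSep H T i j)

/-- The variable DAG `A` is groupwise Markov equivalent to the group DAG `H`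
given the grouping whose groups are the fibers of the surjection `π`. -/
def GroupwiseMarkovEquiv (A : V → V → Prop) (π : V → I) (H : I → I → Prop) : Prop :=
  ∀ i j : I, i ≠ j → ∀ T : Set I, i ∉ T → j ∉ T →
    (DSepSet A (π ⁻¹' T) (π ⁻¹' {i}) (π ⁻¹' {j}) ↔ DSep H T i j)

section Graph

variable {A : V → V → Prop} {Z : Set V} {u v w : V}

/-- The conditions that an interior node `b`, entered from `a` and left to `c`, must satisfy on a
path that is active given `Z`. -/
def ActiveAt (A : V → V → Prop) (Z : Set V) (a b c : V) : Prop :=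
  (A a b ∧ A c b → (b ∈ Z ∨ ∃ d ∈ Z, Ancestor A b d)) ∧ (¬ (A a b ∧ A c b) → b ∉ Z)

/-- `f 0, …, f (n + 1)` is a path from `u` to `v` that is active given `Z`. -/
structure IsActivePath (A : V → V → Prop) (Z : Set V) (u v : V) (n : ℕ) (f : ℕ → V) : Prop where
  inj : ∀ i j, i ≤ n + 1 → j ≤ n + 1 → f i = f j → i = j
  first : f 0 = u
  last : f (n + 1) = v
  adj : ∀ k ≤ n, Adj A (f k) (f (k + 1))
  active : ∀ k < n, ActiveAt A Z (f k) (f (k + 1)) (f (k + 2))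

theorem dconn_iff : DConn A Z u v ↔ ∃ n f, IsActivePath A Z u v n f := by
  constructor
  · rintro ⟨n, q, hinj, h0, h1, hadj, hact⟩
    obtain ⟨f, key⟩ : ∃ f : ℕ → V, ∀ k (hk : k < n + 2), f k = q ⟨k, hk⟩ :=
      ⟨fun k => if h : k < n + 2 then q ⟨k, h⟩ else q 0, fun k hk => dif_pos hk⟩
    refine ⟨n, f, ?_, ?_, ?_, ?_, ?_⟩
    · intro i j hi hj hij
      rw [key i (by omega), key j (by omega)] at hij
      simpa using hinj hij
    · rw [key 0 (by omega)]
      exact h0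
    · rw [key (n + 1) (by omega)]
      exact h1
    · intro k hk
      rw [key k (by omega), key (k + 1) (by omega)]
      exact hadj k (by omega)
    · intro k hk
      rw [key k (by omega), key (k + 1) (by omega), key (k + 2) (by omega)]
      exact hact k (by omega)
  · rintro ⟨n, f, hf⟩
    refine ⟨n, fun i => f i, ?_, hf.first, hf.last, ?_, ?_⟩
    · intro i j hij
      exact Fin.ext (hf.inj i j (by omega) (by omega) hij)
    · intro k hk
      exact hf.adj k (by omega)
    · intro k hk
      exact hf.active k (by omega)

theorem Adj.symm (h : Adj A u v) : Adj A v u := Or.symm h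

theorem ActiveAt.symm {a b c : V} (h : ActiveAt A Z a b c) : ActiveAt A Z c b a :=
  ⟨fun h' => h.1 h'.symm, fun h' => h.2 fun h'' => h' h''.symm⟩

theorem DConn.symm (h : DConn A Z u v) : DConn A Z v u := by
  obtain ⟨n, f, hf⟩ := dconn_iff.1 h
  refine dconn_iff.2 ⟨n, fun k => f (n + 1 - k), ?_, ?_, ?_, ?_, ?_⟩
  · intro i j hi hj hij
    have := hf.inj _ _ (by omega) (by omega) hij
    omega
  · exact hf.last
  · simpa using hf.first
  · intro k hk
    have := (hf.adj (n - k) (by omega)).symm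
    rwa [show n - k + 1 = n + 1 - k by omega, show n - k = n + 1 - (k + 1) by omega] at this
  · intro k hk
    have := (hf.active (n - k - 1) (by omega)).symm
    rwa [show n - k - 1 + 2 = n + 1 - k by omega, show n - k - 1 + 1 = n + 1 - (k + 1) by omega,
      show n - k - 1 = n + 1 - (k + 2) by omega] at this

theorem IsActivePath.truncate {n : ℕ} {f : ℕ → V} (hf : IsActivePath A Z u v n f) {m : ℕ}
    (hm : m ≤ n) : IsActivePath A Z u (f (m + 1)) m f :=
  ⟨fun i j hi hj => hf.inj i j (by omega) (by omega), hf.first, rfl,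
    fun k hk => hf.adj k (by omega), fun k hk => hf.active k (by omega)⟩

theorem dconn_of_adj (huv : u ≠ v) (h : Adj A u v) : DConn A Z u v := by
  refine dconn_iff.2 ⟨0, fun k => if k = 0 then u else v, ?_, rfl, rfl, ?_, ?_⟩
  · intro i j hi hj hij
    by_cases h0 : i = 0 <;> by_cases h1 : j = 0 <;> simp [h0, h1] at hij <;>
      first
      | omega
      | exact absurd hij huv
      | exact absurd hij.symm huv
  · intro k hk
    obtain rfl : k = 0 := by omega
    simpa using h
  · intro k hk
    omega

theorem IsDAG.asymm (hA : IsDAG A) (h : A u v) : ¬ A v u := fun hvu =>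
  hA u (.tail (.single h) hvu)

/-- An active path can be prolonged along an arc leaving its last node. -/
theorem dconn_extend (hA : IsDAG A) {c d : V} (h : c = u ∨ DConn A Z u c) (hcd : A c d)
    (hc : c ∉ Z) : d = u ∨ DConn A Z u d := by
  by_cases hd : d = u
  · exact Or.inl hd
  right
  rcases h with rfl | h
  · exact dconn_of_adj (Ne.symm hd) (Or.inl hcd)
  obtain ⟨n, f, hf⟩ := dconn_iff.1 h
  by_cases hmem : ∃ j ≤ n + 1, f j = d
  · obtain ⟨j, hj, rfl⟩ := hmem
    rcases j with _ | j
    · exact absurd hf.first hd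
    · exact dconn_iff.2 ⟨j, f, hf.truncate (by omega)⟩
  push Not at hmem
  obtain ⟨g, key, key'⟩ : ∃ g : ℕ → V, (∀ k, k ≤ n + 1 → g k = f k) ∧ g (n + 2) = d :=
    ⟨fun k => if k ≤ n + 1 then f k else d, fun k hk => if_pos hk, if_neg (by omega)⟩
  refine dconn_iff.2 ⟨n + 1, g, ?_, ?_, ?_, ?_, ?_⟩
  · intro i j hi hj hij
    by_cases h0 : i ≤ n + 1 <;> by_cases h1 : j ≤ n + 1
    · rw [key i h0, key j h1] at hij
      exact hf.inj i j h0 h1 hij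
    · obtain rfl : j = n + 2 := by omega
      rw [key i h0, key'] at hij
      exact absurd hij (hmem i h0)
    · obtain rfl : i = n + 2 := by omega
      rw [key j h1, key'] at hij
      exact absurd hij.symm (hmem j h1)
    · omega
  · rw [key 0 (by omega)]
    exact hf.first
  · exact key'
  · intro k hk
    rcases Nat.lt_or_ge n k with h' | h'
    · obtain rfl : k = n + 1 := by omega
      rw [key _ le_rfl, key', hf.last]
      exact Or.inl hcd
    · rw [key k (by omega), key (k + 1) (by omega)]
      exact hf.adj k h'
  · intro k hk
    rcases Nat.lt_or_ge k n with h' | h'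
    · rw [key k (by omega), key (k + 1) (by omega), key (k + 2) (by omega)]
      exact hf.active k h'
    · obtain rfl : k = n := by omega
      rw [key k (by omega), key (k + 1) le_rfl, key', hf.last]
      exact ⟨fun h'' => absurd h''.2 (hA.asymm hcd), fun _ => hc⟩

/-- Weak transitivity: if conditioning on `w` in addition opens a path, then `w` is reachable. -/
theorem DConn.of_insert (hA : IsDAG A) (hw : w ≠ u) (h : DConn A (insert w Z) u v) :
    DConn A Z u v ∨ DConn A Z u w := by
  obtain ⟨n, f, hf⟩ := dconn_iff.1 h
  have good : ∀ k < n, (f (k + 1) ∈ Z ∨ ∃ d ∈ Z, Ancestor A (f (k + 1)) d) ∨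
      ¬ (A (f k) (f (k + 1)) ∧ A (f (k + 2)) (f (k + 1))) →
      ActiveAt A Z (f k) (f (k + 1)) (f (k + 2)) := fun k hk hor =>
    ⟨fun hc => hor.resolve_right (not_not.2 hc),
      fun hc hz => (hf.active k hk).2 hc (Set.mem_insert_of_mem _ hz)⟩
  by_cases hbad : ∃ k, k < n ∧ ¬ ((f (k + 1) ∈ Z ∨ ∃ d ∈ Z, Ancestor A (f (k + 1)) d) ∨
      ¬ (A (f k) (f (k + 1)) ∧ A (f (k + 2)) (f (k + 1))))
  swap
  · push Not at hbad
    exact Or.inl (dconn_iff.2 ⟨n, f, hf.inj, hf.first, hf.last, hf.adj,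
      fun k hk => good k hk (or_iff_not_imp_left.2 fun h1 h2 => by
        by_contra
        push Not at h1
        exact absurd (hbad k hk) (by tauto))⟩)
  right
  set k := Nat.find hbad with hkdef
  obtain ⟨hkn, hk⟩ := Nat.find_spec hbad
  rw [← hkdef] at hkn hk
  push Not at hk
  obtain ⟨⟨hkZ, hkanc⟩, hcol⟩ := hk
  have hbase : DConn A Z u (f (k + 1)) := by
    refine dconn_iff.2 ⟨k, f, fun i j hi hj => hf.inj i j (by omega) (by omega), hf.first, rfl,
      fun i hi => hf.adj i (by omega), fun i hi => good i (by omega) ?_⟩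
    have := Nat.find_min hbad hi
    by_contra hcon
    exact this ⟨by omega, hcon⟩
  have hreach : Relation.ReflTransGen A (f (k + 1)) w := by
    rcases (hf.active k hkn).1 hcol with h' | ⟨d, hd, hanc⟩
    · rcases h' with h' | h'
      · rw [h']
      · exact absurd h' hkZ
    · rcases hd with rfl | hd
      · exact hanc.to_reflTransGen
      · exact absurd hanc (hkanc d hd)
  have hnot : ∀ e, Relation.ReflTransGen A (f (k + 1)) e → e ∉ Z := by
    intro e he hz
    rcases Relation.reflTransGen_iff_eq_or_transGen.1 he with h' | h'
    · exact hkZ (h' ▸ hz)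
    · exact hkanc e hz h'
  have : w = u ∨ DConn A Z u w := by
    clear_value k
    clear hw h hf
    induction hreach with
    | refl => exact Or.inr hbase
    | tail hab hbc ih => exact dconn_extend hA ih hbc (hnot _ hab)
  exact this.resolve_left hw

theorem IsActivePath.mem_of_closed {n : ℕ} {f : ℕ → V} (hf : IsActivePath A Z u v n f)
    {S : Set V} (hS : ∀ a ∈ S, ∀ b, Adj A a b → b ∈ S) (hu : u ∈ S) : ∀ k ≤ n + 1, f k ∈ S := by
  intro k
  induction k with
  | zero => exact fun _ => hf.first ▸ hu
  | succ k ih => exact fun hk => hS _ (ih (by omega)) _ (hf.adj k (by omega))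

theorem DConn.mem_of_closed (h : DConn A Z u v) {S : Set V}
    (hS : ∀ a ∈ S, ∀ b, Adj A a b → b ∈ S) (hu : u ∈ S) : v ∈ S := by
  obtain ⟨n, f, hf⟩ := dconn_iff.1 h
  exact hf.last ▸ hf.mem_of_closed hS hu (n + 1) le_rfl

/-- D-connection is transported along maps that embed a union of connected components. -/
theorem DConn.map {B : I → I → Prop} {Z' : Set I} (g : V → I) {S : Set V}
    (hS : ∀ a ∈ S, ∀ b, Adj A a b → b ∈ S) (hg : Set.InjOn g S)
    (hAB : ∀ a ∈ S, ∀ b ∈ S, (B (g a) (g b) ↔ A a b)) (hZ : ∀ a ∈ S, (g a ∈ Z' ↔ a ∈ Z))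
    (hu : u ∈ S) (h : DConn A Z u v) : DConn B Z' (g u) (g v) := by
  obtain ⟨n, f, hf⟩ := dconn_iff.1 h
  have hmem := hf.mem_of_closed hS hu
  have hanc : ∀ a ∈ S, ∀ d, Ancestor A a d → d ∈ S ∧ Ancestor B (g a) (g d) := by
    intro a ha d had
    induction had with
    | single h' =>
      have hd := hS _ ha _ (Or.inl h')
      exact ⟨hd, .single ((hAB _ ha _ hd).2 h')⟩
    | tail _ h' ih =>
      have hd := hS _ ih.1 _ (Or.inl h')
      exact ⟨hd, .tail ih.2 ((hAB _ ih.1 _ hd).2 h')⟩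
  refine dconn_iff.2 ⟨n, fun k => g (f k), ?_, congrArg g hf.first, congrArg g hf.last, ?_, ?_⟩
  · intro i j hi hj hij
    exact hf.inj i j hi hj (hg (hmem i hi) (hmem j hj) hij)
  · intro k hk
    have h0 := hmem k (by omega)
    have h1 := hmem (k + 1) (by omega)
    exact (hf.adj k hk).imp (hAB _ h0 _ h1).2 (hAB _ h1 _ h0).2
  · intro k hk
    have h0 := hmem k (by omega)
    have h1 := hmem (k + 1) (by omega)
    have h2 := hmem (k + 2) (by omega)
    have hact := hf.active k hk
    simp only [ActiveAt, hAB _ h0 _ h1, hAB _ h2 _ h1, hZ _ h1] at hact ⊢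
    refine ⟨fun hc => (hact.1 hc).imp id ?_, hact.2⟩
    rintro ⟨d, hd, had⟩
    obtain ⟨hdS, hgd⟩ := hanc _ h1 d had
    exact ⟨g d, (hZ d hdS).2 hd, hgd⟩

end Graph

section Semigraphoid

variable [Fintype V] [DecidableEq V] [∀ v, Fintype (S v)] {p : (∀ v, S v) → ℝ} {X Y Z W : Set V}

theorem margin_congr {a b : ∀ v, S v} (h : ∀ v ∈ X, a v = b v) :
    margin p X a = margin p X b := by
  unfold margin
  refine Finset.sum_congr rfl fun f _ => ?_
  have : (∀ v ∈ X, f v = a v) ↔ ∀ v ∈ X, f v = b v :=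
    forall₂_congr fun v hv => by rw [h v hv]
  simp only [this]

theorem margin_nonneg (hp : ∀ f, 0 ≤ p f) (X : Set V) (a : ∀ v, S v) : 0 ≤ margin p X a :=
  Finset.sum_nonneg fun f _ => by split_ifs <;> simp [hp]

theorem margin_anti (hp : ∀ f, 0 ≤ p f) (h : X ⊆ Y) (a : ∀ v, S v) :
    margin p Y a ≤ margin p X a := by
  refine Finset.sum_le_sum fun f _ => ?_
  by_cases hY : ∀ v ∈ Y, f v = a v
  · rw [if_pos hY, if_pos fun v hv => hY v (h hv)]
  · rw [if_neg hY]
    split_ifs <;> simp [hp]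

theorem margin_eq_sum_insert {w : V} (hw : w ∉ X) (a : ∀ v, S v) :
    margin p X a = ∑ s, margin p (insert w X) (Function.update a w s) := by
  unfold margin
  rw [Finset.sum_comm]
  refine Finset.sum_congr rfl fun f _ => ?_
  have : ∀ s, (∀ v ∈ insert w X, f v = Function.update a w s v) ↔
      (s = f w ∧ ∀ v ∈ X, f v = a v) := by
    intro s
    rw [Set.forall_mem_insert, Function.update_self, eq_comm]
    refine and_congr_right fun _ => forall₂_congr fun v hv => ?_
    rw [Function.update_of_ne (ne_of_mem_of_not_mem hv hw)]
  simp only [this, ite_and]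
  simp

theorem CondIndep.symm (h : CondIndep p X Y Z) : CondIndep p Y X Z := by
  intro a ha
  rw [Set.union_comm Y X, h a ha, mul_comm]

theorem condIndep_empty_right (X Z : Set V) : CondIndep p X ∅ Z := by
  intro a _
  simp

theorem CondIndep.of_insert {w : V} (hw : w ∉ X) (h : CondIndep p X (insert w Y) Z) :
    CondIndep p X Y Z := by
  by_cases hwYZ : w ∈ Y ∪ Z
  · have e : insert w Y ∪ Z = Y ∪ Z := by
      rw [Set.insert_union, Set.insert_eq_of_mem hwYZ]
    intro a ha
    have := h a ha
    rwa [Set.union_assoc, e, ← Set.union_assoc] at this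
  · intro a ha
    have hwZ : w ∉ Z := fun h' => hwYZ (Or.inr h')
    have hup : ∀ (Q : Set V), w ∉ Q → ∀ s, margin p Q (Function.update a w s) = margin p Q a :=
      fun Q hQ s => margin_congr fun v hv =>
        Function.update_of_ne (ne_of_mem_of_not_mem hv hQ) _ _
    have hXZ : w ∉ X ∪ Z := by simp [hw, hwZ]
    have hXYZ : w ∉ X ∪ Y ∪ Z := by
      rw [Set.union_assoc]
      simp only [Set.mem_union] at hwYZ ⊢
      tauto
    rw [margin_eq_sum_insert hXYZ, margin_eq_sum_insert hwYZ, Finset.sum_mul, Finset.mul_sum]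
    refine Finset.sum_congr rfl fun s _ => ?_
    have := h (Function.update a w s) (by rwa [hup Z hwZ])
    rwa [hup Z hwZ, hup _ hXZ, Set.union_insert, Set.insert_union, Set.insert_union] at this

theorem CondIndep.mono_right (hd : Disjoint X Y) (h : CondIndep p X Y Z) (hW : W ⊆ Y) :
    CondIndep p X W Z := by
  have key : ∀ U : Set V, Disjoint X U → CondIndep p X (U ∪ W) Z → CondIndep p X W Z := by
    intro U
    induction U, U.toFinite using Set.Finite.induction_on with
    | empty => simp
    | insert ha hs ih =>
      intro hdisj hci
      rw [Set.disjoint_insert_right] at hdisj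
      rw [Set.insert_union] at hci
      exact ih hdisj.2 (hci.of_insert hdisj.1)
  exact key Y hd (by rwa [Set.union_eq_self_of_subset_right hW])

theorem CondIndep.mono (hd : Disjoint X Y) (h : CondIndep p X Y Z) {X' Y' : Set V}
    (hX : X' ⊆ X) (hY : Y' ⊆ Y) : CondIndep p X' Y' Z :=
  ((h.mono_right hd hY).symm.mono_right (hd.mono_right hY).symm hX).symm

theorem CondIndep.weak_union (hp : ∀ f, 0 ≤ p f) (hd : Disjoint X (Y ∪ W))
    (h : CondIndep p X (Y ∪ W) Z) : CondIndep p X Y (Z ∪ W) := by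
  intro a ha
  have hZ : 0 < margin p Z a := ha.trans_le (margin_anti hp Set.subset_union_left a)
  have h1 := h a hZ
  have h2 := (h.mono_right hd Set.subset_union_right) a hZ
  have e1 : X ∪ (Y ∪ W) ∪ Z = X ∪ Y ∪ (Z ∪ W) := by
    ext
    simp only [Set.mem_union]
    tauto
  have e2 : Y ∪ W ∪ Z = Y ∪ (Z ∪ W) := by rw [Set.union_assoc, Set.union_comm W]
  have e3 : X ∪ W ∪ Z = X ∪ (Z ∪ W) := by rw [Set.union_assoc, Set.union_comm W]
  rw [e1, e2] at h1
  rw [e3, Set.union_comm W] at h2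
  refine mul_right_cancel₀ hZ.ne' ?_
  linear_combination margin p (Z ∪ W) a * h1 - margin p (Y ∪ (Z ∪ W)) a * h2

theorem CondIndep.contraction (hp : ∀ f, 0 ≤ p f) (h1 : CondIndep p X Y (Z ∪ W))
    (h2 : CondIndep p X W Z) : CondIndep p X (Y ∪ W) Z := by
  intro a ha
  have e1 : X ∪ (Y ∪ W) ∪ Z = X ∪ Y ∪ (Z ∪ W) := by
    ext
    simp only [Set.mem_union]
    tauto
  have e2 : Y ∪ W ∪ Z = Y ∪ (Z ∪ W) := by rw [Set.union_assoc, Set.union_comm W]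
  have e3 : X ∪ W ∪ Z = X ∪ (Z ∪ W) := by rw [Set.union_assoc, Set.union_comm W]
  have h2 := h2 a ha
  rw [e3, Set.union_comm W] at h2
  rw [e1, e2]
  rcases (margin_nonneg hp (Z ∪ W) a).eq_or_lt with h0 | hpos
  · have hz : ∀ Q : Set V, margin p (Q ∪ (Z ∪ W)) a = 0 := fun Q =>
      le_antisymm (h0 ▸ margin_anti hp Set.subset_union_right a) (margin_nonneg hp _ a)
    rw [hz, hz]
    simp
  · have h1 := h1 a hpos
    refine mul_right_cancel₀ hpos.ne' ?_
    linear_combination margin p Z a * h1 + margin p (Y ∪ (Z ∪ W)) a * h2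

/-- Conditioning variables that are independent of everything else are irrelevant. -/
theorem condIndep_union_iff (hp : ∀ f, 0 ≤ p f) {P Q : Set V} (hPQ : Disjoint P Q)
    (h : CondIndep p P Q ∅) (hX : X ⊆ P) (hY : Y ⊆ P) (hZ : Z ⊆ P) (hW : W ⊆ Q)
    (hXY : Disjoint X Y) : CondIndep p X Y (Z ∪ W) ↔ CondIndep p X Y Z := by
  have hXW : Disjoint X W := hPQ.mono hX hW
  have base : ∀ R ⊆ P, CondIndep p X W R := by
    intro R hR
    have : CondIndep p W (X ∪ R) ∅ := (h.mono hPQ (Set.union_subset hX hR) hW).symm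
    have := this.weak_union hp (hPQ.mono (Set.union_subset hX hR) hW).symm
    rw [Set.empty_union] at this
    exact this.symm
  have hd : Disjoint X (W ∪ Y) := Set.disjoint_union_right.2 ⟨hXW, hXY⟩
  constructor
  · intro h'
    exact (h'.contraction hp (base Z hZ)).mono_right (Set.union_comm W Y ▸ hd)
      Set.subset_union_left
  · intro h'
    have h2 := (base (Z ∪ Y) (Set.union_subset hZ hY)).contraction hp h'
    rw [Set.union_comm W] at h2 hd
    exact h2.weak_union hp hd

/-- Faithfulness can be checked on pairs of single variables. -/
theorem faithful_of_pairwise (hp : ∀ f, 0 ≤ p f) {A : V → V → Prop} (hA : IsDAG A)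
    (h : ∀ u v : V, u ≠ v → ∀ Z : Set V, u ∉ Z → v ∉ Z →
      (CondIndep p {u} {v} Z ↔ DSep A Z u v)) : Faithful p A := by
  have single : ∀ (x : V) (Y Z : Set V), x ∉ Y → x ∉ Z → Disjoint Y Z →
      (∀ y ∈ Y, DSep A Z x y) → CondIndep p {x} Y Z := by
    intro x Y
    induction Y, Y.toFinite using Set.Finite.induction_on with
    | empty => exact fun Z _ _ _ _ => condIndep_empty_right _ _
    | @insert y Y hy _ ih =>
      intro Z hxY hxZ hYZ hsep
      rw [Set.mem_insert_iff, not_or] at hxY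
      rw [Set.disjoint_insert_left] at hYZ
      rw [Set.insert_eq, Set.union_comm]
      refine CondIndep.contraction hp ?_
        ((h x y hxY.1 Z hxZ hYZ.1).2 (hsep y (Set.mem_insert _ _)))
      rw [Set.union_singleton]
      refine ih _ hxY.2 (by simp [hxY.1, hxZ]) (Set.disjoint_insert_right.2 ⟨hy, hYZ.2⟩) ?_
      intro y' hy' hcon
      rcases hcon.of_insert hA (Ne.symm hxY.1) with h' | h'
      · exact hsep y' (Set.mem_insert_of_mem _ hy') h'
      · exact hsep y (Set.mem_insert _ _) h'
  have sets : ∀ (Y X Z : Set V), Disjoint X Y → Disjoint X Z → Disjoint Y Z →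
      DSepSet A Z X Y → CondIndep p Y X Z := by
    intro Y X
    induction X, X.toFinite using Set.Finite.induction_on with
    | empty => exact fun Z _ _ _ _ => condIndep_empty_right _ _
    | @insert x X hx _ ih =>
      intro Z hXY hXZ hYZ hsep
      rw [Set.disjoint_insert_left] at hXY hXZ
      rw [Set.insert_eq, Set.union_comm]
      refine CondIndep.contraction hp ?_
        (single x Y Z hXY.1 hXZ.1 hYZ (hsep x (Set.mem_insert _ _))).symm
      rw [Set.union_singleton]
      refine ih _ hXY.2 (Set.disjoint_insert_right.2 ⟨hx, hXZ.2⟩)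
        (Set.disjoint_insert_right.2 ⟨hXY.1, hYZ⟩) ?_
      intro x' hx' y hy hcon
      rcases hcon.symm.of_insert hA (ne_of_mem_of_not_mem hy hXY.1).symm with h' | h'
      · exact hsep x' (Set.mem_insert_of_mem _ hx') y hy h'.symm
      · exact hsep x (Set.mem_insert _ _) y hy h'.symm
  intro X Y Z _ _ hXY hXZ hYZ
  constructor
  · intro hci x hx y hy
    exact (h x y (hXY.ne_of_mem hx hy) Z (hXZ.notMem_of_mem_left hx)
      (hYZ.notMem_of_mem_left hy)).1
      (hci.mono hXY (Set.singleton_subset_iff.2 hx) (Set.singleton_subset_iff.2 hy))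
  · exact fun hsep => (sets Y X Z hXY hXZ hYZ hsep).symm

end Semigraphoid

section Groups

variable [Fintype V] [DecidableEq V] [∀ v, Fintype (S v)] {p : (∀ v, S v) → ℝ}
  {π : V → I} {H : I → I → Prop}

/-- A group that is isolated in `H` is independent of the union of the other groups. -/
theorem GroupwiseFaithful.condIndep_isolated [Finite I] (hgf : GroupwiseFaithful p π H)
    (hp : ∀ f, 0 ≤ p f) {i : I} (hi : ∀ j, i ≠ j → ¬ Adj H i j) (T : Set I)
    (hT : i ∉ T) : CondIndep p (π ⁻¹' {i}) (π ⁻¹' T) ∅ := by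
  induction T, T.toFinite using Set.Finite.induction_on with
  | empty => exact condIndep_empty_right _ _
  | @insert j T hj _ ih =>
    rw [Set.mem_insert_iff, not_or] at hT
    rw [Set.insert_eq, Set.preimage_union]
    refine CondIndep.contraction hp ?_ (ih hT.2)
    rw [Set.empty_union]
    refine (hgf i j hT.1 T hT.2 hj).2 fun hcon => ?_
    have hmem : j ∈ ({i} : Set I) := by
      refine hcon.mem_of_closed ?_ (Set.mem_singleton i)
      rintro a rfl b hab
      by_contra hb
      exact hi b (Ne.symm hb) hab
    exact hT.1 hmem.symm

/-- A union of isolated groups is independent of the union of any other groups. -/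
theorem GroupwiseFaithful.condIndep_isolated_union [Finite I] (hgf : GroupwiseFaithful p π H)
    (hp : ∀ f, 0 ≤ p f) (J : Set I) (hJ : ∀ i ∈ J, ∀ j, i ≠ j → ¬ Adj H i j)
    (K : Set I) (hKJ : Disjoint K J) :
    CondIndep p (π ⁻¹' K) (π ⁻¹' J) ∅ := by
  induction J, J.toFinite using Set.Finite.induction_on with
  | empty => exact condIndep_empty_right _ _
  | @insert j J hj _ ih =>
    rw [Set.disjoint_insert_right] at hKJ
    rw [Set.insert_eq, Set.preimage_union]
    refine CondIndep.contraction hp ?_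
      (ih (fun i hi => hJ i (Set.mem_insert_of_mem _ hi)) hKJ.2)
    have hjKJ : j ∉ K ∪ J := by simp [hKJ.1, hj]
    have := hgf.condIndep_isolated hp (hJ j (Set.mem_insert _ _)) (K ∪ J) hjKJ
    rw [Set.preimage_union] at this
    refine (this.weak_union hp ?_).symm
    rw [← Set.preimage_union]
    exact (Set.disjoint_singleton_left.2 hjKJ).preimage π

/-- Arcs between different groups are copied from `H`; inside a group, dependent variables are
joined by an arc directed along the enumeration of the variables. -/
def liftArc (p : (∀ v, S v) → ℝ) (π : V → I) (H : I → I → Prop) (u v : V) : Prop :=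
  (π u ≠ π v ∧ H (π u) (π v)) ∨
    (π u = π v ∧ Fintype.equivFin V u < Fintype.equivFin V v ∧ ¬ CondIndep p {u} {v} ∅)

theorem isDAG_liftArc (hH : IsDAG H) : IsDAG (liftArc p π H) := by
  have key : ∀ u v, Relation.TransGen (liftArc p π H) u v → Relation.TransGen H (π u) (π v) ∨
      (π u = π v ∧ Fintype.equivFin V u < Fintype.equivFin V v) := by
    intro u v h
    induction h with
    | single h' => exact h'.imp (fun h'' => .single h''.2) fun h'' => ⟨h''.1, h''.2.1⟩
    | tail _ h' ih =>
      rcases ih with ih | ih <;> rcases h' with h' | h'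
      · exact Or.inl (ih.tail h'.2)
      · exact Or.inl (h'.1 ▸ ih)
      · exact Or.inl (.single (ih.1 ▸ h'.2))
      · exact Or.inr ⟨ih.1.trans h'.1, ih.2.trans h'.2.1⟩
  intro v hv
  rcases key v v hv with h | h
  · exact hH _ h
  · exact lt_irrefl _ h.2

theorem adj_liftArc_of_eq {u v : V} (huv : u ≠ v) (hπ : π u = π v) :
    Adj (liftArc p π H) u v ↔ ¬ CondIndep p {u} {v} ∅ := by
  constructor
  · rintro (h | h) <;> rcases h with h | h
    · exact absurd hπ h.1
    · exact h.2.2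
    · exact absurd hπ.symm h.1
    · exact fun h' => h.2.2 h'.symm
  · intro h
    rcases lt_or_gt_of_ne ((Fintype.equivFin V).injective.ne huv) with h' | h'
    · exact Or.inl (Or.inr ⟨hπ, h', h⟩)
    · exact Or.inr (Or.inr ⟨hπ.symm, h', fun h'' => h h''.symm⟩)

theorem adj_of_adj_liftArc {u v : V} (hπ : π u ≠ π v) (h : Adj (liftArc p π H) u v) :
    Adj H (π u) (π v) :=
  h.imp (fun h' => (h'.resolve_right fun h'' => hπ h''.1).2)
    fun h' => (h'.resolve_right fun h'' => hπ h''.1.symm).2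

end Groups

/-- Lemma 10 of the paper. If the maximum group size is 2 and no
group of size 2 is adjacent to any other group in the group DAG `H`, then every
distribution that is groupwise faithful to `H` given the grouping is faithful to
some DAG on the variables. -/
theorem groupwise_faithful_size_two_isolated_implies_faithful
    {V I : Type*} [Fintype V] [Fintype I] [DecidableEq V]
    {S : V → Type*} [∀ v, Fintype (S v)]
    (hS : ∀ v : V, 2 ≤ Fintype.card (S v))
    (π : V → I) (hπ : Function.Surjective π)
    (H : I → I → Prop) (hH : IsDAG H)
    (hmax : ∀ i : I, (π ⁻¹' {i}).ncard ≤ 2)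
    (hmax2 : ∃ i : I, (π ⁻¹' {i}).ncard = 2)
    (hiso : ∀ i j : I, (π ⁻¹' {i}).ncard = 2 → i ≠ j → ¬ Adj H i j)
    (p : (∀ v, S v) → ℝ) (hp : IsDist p)
    (hgf : GroupwiseFaithful p π H) :
    ∃ G : V → V → Prop, IsDAG G ∧ Faithful p G := by
  have hpn := hp.1
  have hirr : ∀ i, ¬ H i i := fun i h => hH i (.single h)
  have hfib : ∀ u v w : V, π u = π v → π w = π u → u ≠ v → w = u ∨ w = v := by
    intro u v w huv hwu hne
    by_contra hcon
    push Not at hcon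
    have hcard : ({u, v, w} : Set V).ncard = 3 :=
      Set.ncard_eq_three.2 ⟨u, v, w, hne, hcon.1.symm, hcon.2.symm, rfl⟩
    have hle := Set.ncard_le_ncard (s := {u, v, w}) (t := π ⁻¹' {π u})
      (by rintro x (rfl | rfl | rfl) <;> simp [huv, hwu]) (Set.toFinite _)
    have := hmax (π u)
    omega
  set I₂ : Set I := {i | (π ⁻¹' {i}).ncard = 2} with hI₂
  have htwo : ∀ u v : V, π u = π v → u ≠ v → π u ∈ I₂ := by
    intro u v huv hne
    have hle := Set.ncard_le_ncard (s := {u, v}) (t := π ⁻¹' {π u})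
      (by rintro x (rfl | rfl) <;> simp [huv]) (Set.toFinite _)
    rw [Set.ncard_pair hne] at hle
    exact le_antisymm (hmax _) hle
  have hiso' : ∀ i ∈ I₂, ∀ j, i ≠ j → ¬ Adj H i j := fun i hi j => hiso i j hi
  have hinj : ∀ u v : V, π u ∉ I₂ → π u = π v → u = v := fun u v hu huv =>
    by_contra fun hne => hu (htwo u v huv hne)
  have hfibind : ∀ i ∈ I₂, CondIndep p (π ⁻¹' {i}) (π ⁻¹' {i}ᶜ) ∅ := fun i hi =>
    hgf.condIndep_isolated hpn (hiso' i hi) {i}ᶜ (by simp)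
  have hfibdisj : ∀ i : I, Disjoint (π ⁻¹' {i}) (π ⁻¹' {i}ᶜ) := fun i =>
    disjoint_compl_right.preimage π
  refine ⟨liftArc p π H, isDAG_liftArc hH, faithful_of_pairwise hpn (isDAG_liftArc hH) ?_⟩
  have hclosed₂ : ∀ i ∈ I₂, ∀ a ∈ π ⁻¹' {i}, ∀ b, Adj (liftArc p π H) a b → b ∈ π ⁻¹' {i} := by
    rintro i hi a rfl b hab
    by_contra hb
    exact hiso' _ hi _ (Ne.symm hb) (adj_of_adj_liftArc (Ne.symm hb) hab)
  have separate : ∀ u v : V, π u ≠ π v → π u ∈ I₂ → ∀ Z : Set V, u ∉ Z → v ∉ Z →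
      CondIndep p {u} {v} Z ∧ DSep (liftArc p π H) Z u v := by
    intro u v huv hu Z huZ hvZ
    constructor
    · have hd : Disjoint {u} ({v} ∪ Z) := by
        rw [Set.disjoint_singleton_left, Set.mem_union, Set.mem_singleton_iff, not_or]
        exact ⟨fun h => huv (h ▸ rfl), huZ⟩
      have h1 : CondIndep p ({u} ∪ Z ∩ π ⁻¹' {π u}) ({v} ∪ Z ∩ π ⁻¹' {π u}ᶜ) ∅ := by
        refine (hfibind _ hu).mono (hfibdisj _) ?_ ?_
        · rintro x (rfl | hx)
          · rfl
          · exact hx.2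
        · rintro x (rfl | hx)
          · exact huv.symm
          · exact hx.2
      have hd1 : Disjoint ({u} ∪ Z ∩ π ⁻¹' {π u}) ({v} ∪ Z ∩ π ⁻¹' {π u}ᶜ) := by
        refine (hfibdisj (π u)).mono ?_ ?_
        · rintro x (rfl | hx)
          · rfl
          · exact hx.2
        · rintro x (rfl | hx)
          · exact huv.symm
          · exact hx.2
      have h2 := (h1.weak_union hpn hd1).symm.weak_union hpn
        (hd1.symm.mono_left Set.subset_union_left)
      have hZ : ∅ ∪ Z ∩ π ⁻¹' {π u}ᶜ ∪ Z ∩ π ⁻¹' {π u} = Z := by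
        rw [Set.empty_union, Set.union_comm, Set.preimage_compl, Set.inter_union_compl]
      rw [hZ] at h2
      exact h2.symm
    · intro hcon
      exact huv (hcon.mem_of_closed (hclosed₂ _ hu) rfl).symm
  intro u v huv Z huZ hvZ
  by_cases hπuv : π u = π v
  · have hu := htwo u v hπuv huv
    have hZ : Z ⊆ π ⁻¹' {π u}ᶜ := by
      intro w hw hwu
      rcases hfib u v w hπuv hwu huv with rfl | rfl
      · exact huZ hw
      · exact hvZ hw
    have h1 := condIndep_union_iff hpn (hfibdisj (π u)) (hfibind _ hu) (X := {u}) (Y := {v})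
      (Z := ∅) (W := Z) (by simp) (by simp [hπuv]) (Set.empty_subset _) hZ (by simpa using huv)
    rw [Set.empty_union] at h1
    rw [h1]
    constructor
    · intro hci hcon
      have hmem : v ∈ ({u} : Set V) := by
        refine hcon.mem_of_closed ?_ (Set.mem_singleton u)
        rintro a rfl b hab
        by_contra hb
        rcases hfib a v b hπuv (hclosed₂ _ hu a rfl b hab) huv with rfl | rfl
        · exact hb rfl
        · exact (adj_liftArc_of_eq huv hπuv).1 hab hci
      exact huv hmem.symm
    · intro hsep
      by_contra hci
      exact hsep (dconn_of_adj huv ((adj_liftArc_of_eq huv hπuv).2 hci))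
  by_cases hu : π u ∈ I₂
  · obtain ⟨h1, h2⟩ := separate u v hπuv hu Z huZ hvZ
    exact iff_of_true h1 h2
  by_cases hv : π v ∈ I₂
  · obtain ⟨h1, h2⟩ := separate v u (Ne.symm hπuv) hv Z hvZ huZ
    exact iff_of_true h1.symm fun h => h2 h.symm
  obtain ⟨σ, hσ⟩ := hπ.hasRightInverse
  have hσπ : ∀ a, π a ∉ I₂ → σ (π a) = a := fun a ha => (hinj a _ ha (hσ _).symm).symm
  set T : Set I := {i | i ∉ I₂ ∧ σ i ∈ Z} with hT
  have hTZ : π ⁻¹' T = Z ∩ π ⁻¹' I₂ᶜ := by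
    ext a
    constructor
    · rintro ⟨h1, h2⟩
      exact ⟨hσπ a h1 ▸ h2, h1⟩
    · rintro ⟨h1, h2⟩
      exact ⟨h2, by rwa [hσπ a h2]⟩
  have hfibsing : ∀ a, π a ∉ I₂ → π ⁻¹' {π a} = {a} := by
    intro a ha
    ext b
    exact ⟨fun hb => (hinj a b ha hb.symm).symm, fun hb => hb ▸ rfl⟩
  have hdisj : Disjoint (π ⁻¹' I₂ᶜ) (π ⁻¹' I₂) := disjoint_compl_left.preimage π
  have hci : CondIndep p {u} {v} Z ↔ CondIndep p {u} {v} (π ⁻¹' T) := by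
    have h1 := condIndep_union_iff hpn hdisj
      (hgf.condIndep_isolated_union hpn I₂ hiso' I₂ᶜ disjoint_compl_left)
      (X := {u}) (Y := {v}) (Z := π ⁻¹' T) (W := Z ∩ π ⁻¹' I₂)
      (Set.singleton_subset_iff.2 hu) (Set.singleton_subset_iff.2 hv)
      (hTZ ▸ Set.inter_subset_right) Set.inter_subset_right (by simpa using huv)
    rw [← h1, hTZ, Set.union_comm, Set.preimage_compl, Set.inter_union_compl]
  have hgr := hgf (π u) (π v) hπuv T (fun h => huZ (hσπ u hu ▸ h.2))
    (fun h => hvZ (hσπ v hv ▸ h.2))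
  rw [hfibsing u hu, hfibsing v hv] at hgr
  rw [hci, hgr]
  have hH₂ : ∀ i ∉ I₂, ∀ j, Adj H i j → j ∉ I₂ := by
    intro i hi j hij hj
    exact hiso' j hj i (fun h => hi (h ▸ hj)) hij.symm
  refine not_congr ⟨fun h => ?_, fun h => ?_⟩
  · rw [← hσπ u hu, ← hσπ v hv]
    refine h.map σ (S := I₂ᶜ) hH₂ hσ.injective.injOn ?_ ?_ hu
    · intro i _ j _
      simp only [liftArc, hσ i, hσ j]
      constructor
      · rintro (h' | h')
        · exact h'.2
        · exact absurd h'.2.1 (by simp [h'.1])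
      · exact fun h' => Or.inl ⟨fun hij => hirr j (hij ▸ h'), h'⟩
    · intro i hi
      exact ⟨fun h' => ⟨hi, h'⟩, fun h' => h'.2⟩
  · refine h.map π (S := π ⁻¹' I₂ᶜ) ?_ ?_ ?_ ?_ hu
    · intro a ha b hab
      by_cases hab' : π a = π b
      · exact fun hb => ha (hab' ▸ hb)
      · exact hH₂ _ ha _ (adj_of_adj_liftArc hab' hab)
    · exact fun a ha b _ hab => hinj a b ha hab
    · intro a ha b _
      constructor
      · exact fun h' => Or.inl ⟨fun hab => hirr _ (hab ▸ h'), h'⟩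
      · rintro (h' | h')
        · exact h'.2
        · obtain rfl := hinj a b ha h'.1
          exact absurd h'.2.1 (lt_irrefl _)
    · intro a ha
      exact ⟨fun h' => hσπ a ha ▸ h'.2, fun h' => ⟨ha, by rwa [hσπ a ha]⟩⟩

end GroupBN
end

section
/- Let H be a group DAG on a grouping W of a finite node set N in which the maximum group size is 2 and two groups of size 2 are adjacent in H. Then there exists a distribution p on N (with binary state spaces) such that p implies the same groupwise conditional independencies as H given W (i.e., p is groupwise faithful to H given W) and p is not faithful to any DAG on N. -/
open scoped Classical

namespace GroupBN

variable {V : Type*} {I : Type*}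

variable {S : V → Type*}

/-! ### Active paths indexed by natural numbers -/

/-- `c` is in `T` or has a descendant in `T`. -/
def Opened {α : Type*} (H : α → α → Prop) (T : Set α) (c : α) : Prop :=
  c ∈ T ∨ ∃ d ∈ T, Ancestor H c d

/-- `q 0, …, q n` is a path from `i` to `x` that is active given `T`. -/
structure ActivePath {α : Type*} (H : α → α → Prop) (T : Set α) (i x : α) (n : ℕ)
    (q : ℕ → α) : Prop where
  inj : ∀ a b, a ≤ n → b ≤ n → q a = q b → a = b
  start : q 0 = i
  finish : q n = x
  adj : ∀ k, k < n → Adj H (q k) (q (k + 1))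
  collider : ∀ k, k + 1 < n → H (q k) (q (k + 1)) → H (q (k + 2)) (q (k + 1)) →
    Opened H T (q (k + 1))
  noncollider : ∀ k, k + 1 < n → ¬ (H (q k) (q (k + 1)) ∧ H (q (k + 2)) (q (k + 1))) →
    q (k + 1) ∉ T

/-- There is an active, possibly trivial, path from `i` to `x` given `T`. -/
def ActiveReach {α : Type*} (H : α → α → Prop) (T : Set α) (i x : α) : Prop :=
  ∃ n q, ActivePath H T i x n q

theorem ActivePath.truncate {α : Type*} {H : α → α → Prop} {T : Set α} {i x : α} {n : ℕ}
    {q : ℕ → α} (h : ActivePath H T i x n q) {m : ℕ} (hm : m ≤ n) :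
    ActivePath H T i (q m) m q where
  inj a b ha hb := h.inj a b (by omega) (by omega)
  start := h.start
  finish := rfl
  adj k hk := h.adj k (by omega)
  collider k hk := h.collider k (by omega)
  noncollider k hk := h.noncollider k (by omega)

theorem ActivePath.append {α : Type*} {H : α → α → Prop} {T : Set α} {i x v : α} {n : ℕ}
    {q : ℕ → α} (h : ActivePath H T i x n q) (hv : ∀ m ≤ n, q m ≠ v) (hadj : Adj H x v)
    (hc : ∀ k, k + 1 = n → H (q k) x → H v x → Opened H T x)
    (hn : ∀ k, k + 1 = n → ¬ (H (q k) x ∧ H v x) → x ∉ T) :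
    ActivePath H T i v (n + 1) (fun k => if k ≤ n then q k else v) where
  inj a b ha hb hab := by
    by_cases h1 : a ≤ n <;> by_cases h2 : b ≤ n <;> simp only [h1, h2, if_true, if_false] at hab
    · exact h.inj a b h1 h2 hab
    · exact absurd hab (hv a h1)
    · exact absurd hab.symm (hv b h2)
    · omega
  start := by simpa using h.start
  finish := by simp
  adj k hk := by
    rcases Nat.lt_or_ge k n with h1 | h1
    · simpa [h1.le, Nat.succ_le_of_lt h1] using h.adj k h1
    · obtain rfl : k = n := by omega
      simpa [h.finish] using hadj
  collider k hk := by
    have h1 : k ≤ n := by omega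
    have h2 : k + 1 ≤ n := by omega
    by_cases h3 : k + 2 ≤ n
    · simpa only [h1, h2, h3, if_true] using h.collider k (by omega)
    · obtain rfl : n = k + 1 := by omega
      simpa [h.finish] using hc k rfl
  noncollider k hk := by
    have h1 : k ≤ n := by omega
    have h2 : k + 1 ≤ n := by omega
    by_cases h3 : k + 2 ≤ n
    · simpa only [h1, h2, h3, if_true] using h.noncollider k (by omega)
    · obtain rfl : n = k + 1 := by omega
      have := hn k rfl
      simpa [h.finish] using this

theorem ActiveReach.symm {α : Type*} {H : α → α → Prop} {T : Set α} {i x : α}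
    (h : ActiveReach H T i x) : ActiveReach H T x i := by
  obtain ⟨n, q, h⟩ := h
  refine ⟨n, fun k => q (n - k), ?_, ?_, ?_, ?_, ?_, ?_⟩
  · intro a b ha hb hab
    have := h.inj _ _ (Nat.sub_le n a) (Nat.sub_le n b) hab
    omega
  · simpa using h.finish
  · simpa using h.start
  · intro k hk
    have := h.adj (n - (k + 1)) (by omega)
    rw [show n - (k + 1) + 1 = n - k by omega] at this
    exact this.symm
  · intro k hk h1 h2
    have := h.collider (n - (k + 2)) (by omega)
    rw [show n - (k + 2) + 1 = n - (k + 1) by omega,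
      show n - (k + 2) + 2 = n - k by omega] at this
    exact this h2 h1
  · intro k hk h1
    have := h.noncollider (n - (k + 2)) (by omega)
    rw [show n - (k + 2) + 1 = n - (k + 1) by omega,
      show n - (k + 2) + 2 = n - k by omega] at this
    exact this fun h2 => h1 h2.symm

theorem dConn_iff_activeReach {α : Type*} {H : α → α → Prop} {T : Set α} {i j : α}
    (hij : i ≠ j) : DConn H T i j ↔ ActiveReach H T i j := by
  constructor
  · rintro ⟨n, pth, hinj, h0, hl, hadj, hcond⟩
    obtain ⟨q, key⟩ : ∃ q : ℕ → α, ∀ k (h : k < n + 2), q k = pth ⟨k, h⟩ :=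
      ⟨fun k => if h : k < n + 2 then pth ⟨k, h⟩ else i, fun k h => by simp [h]⟩
    refine ⟨n + 1, q, ?_, ?_, ?_, ?_, ?_, ?_⟩
    · intro a b ha hb hab
      rw [key a (by omega), key b (by omega)] at hab
      simpa using hinj hab
    · exact (key 0 (by omega)).trans h0
    · exact (key (n + 1) (by omega)).trans hl
    · intro k hk
      rw [key k (by omega), key (k + 1) (by omega)]
      exact hadj k (by omega)
    · intro k hk
      rw [key k (by omega), key (k + 1) (by omega), key (k + 2) (by omega)]
      exact fun h1 h2 => (hcond k (by omega)).1 ⟨h1, h2⟩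
    · intro k hk
      rw [key k (by omega), key (k + 1) (by omega), key (k + 2) (by omega)]
      exact (hcond k (by omega)).2
  · rintro ⟨n, q, h⟩
    obtain _ | n := n
    · exact absurd (h.start.symm.trans h.finish) hij
    · refine ⟨n, fun k => q k, ?_, h.start, h.finish, ?_, ?_⟩
      · intro a b hab
        exact Fin.ext (h.inj a b (by omega) (by omega) hab)
      · intro k hk
        exact h.adj k (by omega)
      · intro k hk
        exact ⟨fun h1 => h.collider k (by omega) h1.1 h1.2, h.noncollider k (by omega)⟩

theorem IsDAG.asymm_s8 {α : Type*} {H : α → α → Prop} (hH : IsDAG H) {u v : α} (h : H u v) :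
    ¬ H v u :=
  fun h' => hH u (.tail (.single h) h')

theorem IsDAG.wellFounded {α : Type*} [Finite α] {H : α → α → Prop} (hH : IsDAG H) :
    WellFounded H := by
  have : Std.Irrefl (Relation.TransGen H) := ⟨hH⟩
  exact Subrelation.wf (fun h => Relation.TransGen.single h)
    (Finite.wellFounded_of_trans_of_irrefl (Relation.TransGen H))

/-- An active path can be extended through an arc between unobserved nodes, provided that
its end point is opened if the arc is traversed backwards. -/
theorem ActiveReach.step {α : Type*} {H : α → α → Prop} (hH : IsDAG H) {T : Set α} {i u v : α}
    (h : ActiveReach H T i u) (hu : u ∉ T) (huv : H u v ∨ (H v u ∧ Opened H T u)) :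
    ActiveReach H T i v := by
  obtain ⟨n, q, h⟩ := h
  by_cases hv : ∃ m ≤ n, q m = v
  · obtain ⟨m, hm, rfl⟩ := hv
    exact ⟨m, q, h.truncate hm⟩
  · push Not at hv
    refine ⟨_, _, h.append hv (huv.imp id And.left) ?_ fun _ _ _ => hu⟩
    rintro - - - hvu
    rcases huv with huv | hopen
    · exact absurd hvu (hH.asymm_s8 huv)
    · exact hopen.2

/-- An active path can be extended through an observed common child. -/
theorem ActiveReach.step_common_child {α : Type*} {H : α → α → Prop} (hH : IsDAG H) {T : Set α}
    {i u v d : α} (h : ActiveReach H T i u) (hu : u ∉ T) (hd : d ∈ T)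
    (hud : H u d) (hvd : H v d) : ActiveReach H T i v := by
  obtain ⟨n, q, h⟩ := h
  by_cases hv : ∃ m ≤ n, q m = v
  · obtain ⟨m, hm, rfl⟩ := hv
    exact ⟨m, q, h.truncate hm⟩
  have hv' : ∀ m ≤ n, q m ≠ v := by simpa using hv
  by_cases hdq : ∃ m ≤ n, q m = d
  · obtain ⟨m, hm, rfl⟩ := hdq
    have hp := h.truncate hm
    refine ⟨_, _, hp.append (fun k hk => hv' k (hk.trans hm)) (.inr hvd)
      (fun _ _ _ _ => .inl hd) ?_⟩
    rintro k rfl hk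
    have hlt : k + 1 < n := by
      refine lt_of_le_of_ne hm ?_
      rintro rfl
      exact hu (h.finish ▸ hd)
    exact h.noncollider k hlt fun h' => hk ⟨h'.1, hvd⟩
  · have hd' : ∀ m ≤ n, q m ≠ d := by simpa using hdq
    have hp := h.append hd' (.inl hud) (fun _ _ _ hdu => absurd hdu (hH.asymm_s8 hud))
      (fun _ _ _ => hu)
    refine ⟨_, _, hp.append ?_ (.inr hvd) (fun _ _ _ _ => .inl hd) ?_⟩
    · intro m hm
      by_cases hmn : m ≤ n
      · simpa [hmn] using hv' m hmn
      · simp only [hmn, if_false]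
        rintro rfl
        exact hH d (.single hvd)
    · intro k hk hnot
      obtain rfl : k = n := by omega
      exact absurd ⟨by simpa [h.finish] using hud, hvd⟩ hnot

/-! ### Sources and unobserved directed paths -/

/-- `u` reaches `v` by a directed path all of whose nodes but the last are outside `T`. -/
def FreeReach {α : Type*} (H : α → α → Prop) (T : Set α) : α → α → Prop :=
  Relation.ReflTransGen fun u v => H u v ∧ u ∉ T

/-- `r` and `r'` freely reach a common observed node. -/
def Share {α : Type*} (H : α → α → Prop) (T : Set α) (r r' : α) : Prop :=
  ∃ d ∈ T, FreeReach H T r d ∧ FreeReach H T r' d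

/-- `r` is linked to a source of `i` by a chain of shared observed nodes. -/
def Linked {α : Type*} (H : α → α → Prop) (T : Set α) (i r : α) : Prop :=
  ∃ r₀, FreeReach H T r₀ i ∧ Relation.ReflTransGen (Share H T) r₀ r

/-- `i` and `j` have linked sources. -/
def Joined {α : Type*} (H : α → α → Prop) (T : Set α) (i j : α) : Prop :=
  ∃ r, Linked H T i r ∧ FreeReach H T r j

theorem Opened.exists_freeReach {α : Type*} {H : α → α → Prop} {T : Set α} {c : α}
    (h : Opened H T c) : ∃ d ∈ T, FreeReach H T c d := by
  rcases h with h | ⟨d, hd, h⟩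
  · exact ⟨c, h, .refl⟩
  · induction h using Relation.TransGen.head_induction_on with
    | @single c hcd =>
      by_cases hc : c ∈ T
      · exact ⟨c, hc, .refl⟩
      · exact ⟨d, hd, .single ⟨hcd, hc⟩⟩
    | @head c c' hcc' _ ih =>
      by_cases hc : c ∈ T
      · exact ⟨c, hc, .refl⟩
      · obtain ⟨d', hd', h'⟩ := ih
        exact ⟨d', hd', .head ⟨hcc', hc⟩ h'⟩

theorem Linked.freeReach {α : Type*} {H : α → α → Prop} {T : Set α} {i r r' : α}
    (h : Linked H T i r) (hr : FreeReach H T r' r) : Linked H T i r' := by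
  obtain ⟨r₀, h0, hs⟩ := h
  rcases Relation.ReflTransGen.cases_tail hs with rfl | ⟨s, hs, d, hd, h1, h2⟩
  · exact ⟨r', hr.trans h0, .refl⟩
  · exact ⟨r₀, h0, hs.tail ⟨d, hd, h1, hr.trans h2⟩⟩

theorem Linked.share {α : Type*} {H : α → α → Prop} {T : Set α} {i r r' : α}
    (h : Linked H T i r) (hr : Share H T r r') : Linked H T i r' := by
  obtain ⟨r₀, h0, hs⟩ := h
  exact ⟨r₀, h0, hs.tail hr⟩

theorem ActivePath.joined {α : Type*} {H : α → α → Prop} (hH : IsDAG H) {T : Set α} {i j : α}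
    {n : ℕ} {q : ℕ → α} (h : ActivePath H T i j n q) (hi : i ∉ T) (hj : j ∉ T) :
    Joined H T i j := by
  have key : ∀ k ≤ n, Joined H T i (q k) ∧
      ((∀ l, l + 1 = k → H (q k) (q l)) → Linked H T i (q k)) := by
    intro k
    induction k with
    | zero =>
      intro _
      have hl : Linked H T i (q 0) := ⟨i, .refl, h.start ▸ .refl⟩
      exact ⟨⟨_, hl, .refl⟩, fun _ => hl⟩
    | succ k ih =>
      intro hk
      obtain ⟨⟨r, hr, hrk⟩, ihl⟩ := ih (by omega)
      rcases h.adj k (by omega) with hkk | hkk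
      · have hkT : q k ∉ T := by
          obtain _ | l := k
          · exact h.start ▸ hi
          · exact h.noncollider l (by omega) fun h' => hH.asymm_s8 hkk h'.2
        exact ⟨⟨r, hr, hrk.tail ⟨hkk, hkT⟩⟩,
          fun h' => absurd (h' k rfl) (hH.asymm_s8 hkk)⟩
      · have hkT : q (k + 1) ∉ T := by
          rcases Nat.lt_or_ge (k + 1) n with hlt | hge
          · exact h.noncollider k hlt fun h' => hH.asymm_s8 hkk h'.1
          · obtain rfl : n = k + 1 := by omega
            exact h.finish ▸ hj
        have hfree : FreeReach H T (q (k + 1)) (q k) := .single ⟨hkk, hkT⟩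
        have hl : Linked H T i (q (k + 1)) := by
          by_cases hup : ∀ l, l + 1 = k → H (q k) (q l)
          · exact (ihl hup).freeReach hfree
          · push Not at hup
            obtain ⟨l, rfl, hl⟩ := hup
            have hdown := (h.adj l (by omega)).resolve_right hl
            obtain ⟨d, hd, hcd⟩ := (h.collider l (by omega) hdown hkk).exists_freeReach
            exact hr.share ⟨d, hd, hrk.trans hcd, hfree.trans hcd⟩
        exact ⟨⟨_, hl, .refl⟩, fun _ => hl⟩
  simpa [h.finish] using (key n le_rfl).1

theorem FreeReach.activeReach {α : Type*} {H : α → α → Prop} (hH : IsDAG H) {T : Set α}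
    {i u v : α} (h : FreeReach H T u v) (hu : ActiveReach H T i u) : ActiveReach H T i v := by
  induction h with
  | refl => exact hu
  | tail _ hbc ih => exact ih.step hH hbc.2 (.inl hbc.1)

theorem FreeReach.opened {α : Type*} {H : α → α → Prop} {T : Set α}
    {u d : α} (h : FreeReach H T u d) (hd : d ∈ T) : Opened H T u := by
  have h' : Relation.ReflTransGen H u d := Relation.ReflTransGen.mono (fun _ _ => And.left) _ _ h
  rcases Relation.reflTransGen_iff_eq_or_transGen.1 h' with rfl | h'
  · exact .inl hd
  · exact .inr ⟨d, hd, h'⟩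

theorem FreeReach.activeReach_reverse {α : Type*} {H : α → α → Prop} (hH : IsDAG H) {T : Set α}
    {i u v d : α} (h : FreeReach H T u v) (hvd : FreeReach H T v d) (hd : d ∈ T) (hv : v ∉ T)
    (hi : ActiveReach H T i v) : ActiveReach H T i u := by
  have key : ActiveReach H T i u ∧ FreeReach H T u d ∧ u ∉ T := by
    induction h using Relation.ReflTransGen.head_induction_on with
    | refl => exact ⟨hi, hvd, hv⟩
    | head hab _ ih =>
      exact ⟨ih.1.step hH ih.2.2 (.inr ⟨hab.1, ih.2.1.opened hd⟩), .head hab ih.2.1, hab.2⟩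
  exact key.1

theorem Share.activeReach {α : Type*} {H : α → α → Prop} (hH : IsDAG H) {T : Set α}
    {i r r' : α} (hr : r ∉ T) (hr' : r' ∉ T) (h : Share H T r r')
    (hir : ActiveReach H T i r) : ActiveReach H T i r' := by
  obtain ⟨d, hd, h1, h2⟩ := h
  rcases Relation.ReflTransGen.cases_tail h1 with rfl | ⟨u, hu, hud⟩
  · exact absurd hd hr
  rcases Relation.ReflTransGen.cases_tail h2 with rfl | ⟨v, hv, hvd⟩
  · exact absurd hd hr'
  have hiv : ActiveReach H T i v :=
    (FreeReach.activeReach hH hu hir).step_common_child hH hud.2 hd hud.1 hvd.1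
  exact FreeReach.activeReach_reverse hH hv (.single hvd) hd hvd.2 hiv

theorem Joined.activeReach {α : Type*} {H : α → α → Prop} (hH : IsDAG H) {T : Set α}
    {i j : α} (hi : i ∉ T) (h : Joined H T i j) : ActiveReach H T i j := by
  obtain ⟨r, ⟨r₀, h0, hs⟩, hrj⟩ := h
  have notMem : ∀ {u v}, FreeReach H T u v → v ∉ T → u ∉ T := by
    intro u v huv hv
    rcases Relation.ReflTransGen.cases_head huv with rfl | ⟨w, hw, -⟩
    exacts [hv, hw.2]
  have key : ∃ r', r' ∉ T ∧ ActiveReach H T i r' ∧ FreeReach H T r' r := by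
    clear hrj
    induction hs with
    | refl =>
      have h' : ActiveReach H T r₀ r₀ :=
        ⟨0, fun _ => r₀, fun a b _ _ _ => by omega, rfl, rfl, fun k hk => by omega,
          fun k hk => by omega, fun k hk => by omega⟩
      exact ⟨r₀, notMem h0 hi, (h0.activeReach hH h').symm, .refl⟩
    | @tail b c _ hbc ih =>
      obtain ⟨d, hd, h1, h2⟩ := hbc
      obtain ⟨r', hr', hir', hr'b⟩ := ih
      by_cases hc : c ∈ T
      · rcases Relation.ReflTransGen.cases_head h2 with rfl | ⟨w, hw, -⟩
        · exact ⟨r', hr', hir', hr'b.trans h1⟩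
        · exact absurd hc hw.2
      · exact ⟨c, hc, Share.activeReach hH hr' hc ⟨d, hd, hr'b.trans h1, h2⟩ hir', .refl⟩
  obtain ⟨r', -, hir', hr'r⟩ := key
  exact FreeReach.activeReach hH (hr'r.trans hrj) hir'

theorem dSep_iff_not_joined {α : Type*} {H : α → α → Prop} (hH : IsDAG H) {T : Set α}
    {i j : α} (hij : i ≠ j) (hi : i ∉ T) (hj : j ∉ T) : DSep H T i j ↔ ¬ Joined H T i j := by
  rw [DSep, dConn_iff_activeReach hij, not_iff_not]
  exact ⟨fun ⟨_, _, h⟩ => h.joined hH hi hj, fun h => h.activeReach hH hi⟩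

/-! ### Shortest chains of sources -/

/-- `r 0, …, r m` is a chain of sources joining `i` and `j`. -/
structure SourceChain {α : Type*} (H : α → α → Prop) (T : Set α) (i j : α) (m : ℕ)
    (r : ℕ → α) : Prop where
  start : FreeReach H T (r 0) i
  finish : FreeReach H T (r m) j
  share : ∀ a < m, Share H T (r a) (r (a + 1))

theorem Joined.exists_sourceChain {α : Type*} {H : α → α → Prop} {T : Set α} {i j : α}
    (h : Joined H T i j) : ∃ m r, SourceChain H T i j m r := by
  obtain ⟨r, ⟨r₀, h0, hs⟩, hrj⟩ := h
  have key : ∃ (m : ℕ) (q : ℕ → α), q 0 = r₀ ∧ q m = r ∧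
      ∀ a < m, Share H T (q a) (q (a + 1)) := by
    clear hrj
    induction hs with
    | refl => exact ⟨0, fun _ => r₀, rfl, rfl, fun a ha => by omega⟩
    | @tail b c _ hbc ih =>
      obtain ⟨m, q, hq0, hqm, hq⟩ := ih
      refine ⟨m + 1, fun k => if k ≤ m then q k else c, by simpa using hq0, by simp, ?_⟩
      intro a ha
      rcases Nat.lt_or_ge a m with h1 | h1
      · simpa [h1.le, Nat.succ_le_of_lt h1] using hq a h1
      · obtain rfl : a = m := by omega
        simpa [hqm] using hbc
  obtain ⟨m, q, rfl, rfl, hq⟩ := key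
  exact ⟨m, q, h0, hrj, hq⟩

/-- A chain of sources without chords. -/
structure InducedChain {α : Type*} (H : α → α → Prop) (T : Set α) (i j : α) (m : ℕ)
    (r : ℕ → α) : Prop extends SourceChain H T i j m r where
  eq_zero : ∀ a ≤ m, FreeReach H T (r a) i → a = 0
  eq_last : ∀ a ≤ m, FreeReach H T (r a) j → a = m
  succ_of_share : ∀ a b, a < b → b ≤ m → Share H T (r a) (r b) → b = a + 1

theorem Joined.exists_inducedChain {α : Type*} {H : α → α → Prop} {T : Set α} {i j : α}
    (h : Joined H T i j) : ∃ m r, InducedChain H T i j m r := by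
  have hex := h.exists_sourceChain
  obtain ⟨r, hr⟩ := Nat.find_spec hex
  have hmin : ∀ m' r', SourceChain H T i j m' r' → Nat.find hex ≤ m' :=
    fun m' r' h' => Nat.find_min' hex ⟨r', h'⟩
  generalize Nat.find hex = m at hr hmin
  refine ⟨m, r, hr, ?_, ?_, ?_⟩
  · intro a ha hai
    have := hmin (m - a) (fun k => r (k + a)) ⟨by simpa using hai,
      by simpa [Nat.sub_add_cancel ha] using hr.finish, fun b hb => by
        simpa [add_right_comm] using hr.share (b + a) (by omega)⟩
    omega
  · intro a ha haj
    have := hmin a r ⟨hr.start, haj, fun b hb => hr.share b (by omega)⟩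
    omega
  · intro a b hab hb hs
    have hm : m - (b - a - 1) = a + 1 + (m - b) := by omega
    have := hmin (m - (b - a - 1)) (fun k => if k ≤ a then r k else r (k + (b - a - 1)))
      ⟨by simpa using hr.start, ?_, ?_⟩
    · omega
    · have h1 : ¬ m - (b - a - 1) ≤ a := by omega
      have h2 : m - (b - a - 1) + (b - a - 1) = m := by omega
      simpa only [h1, h2, if_false] using hr.finish
    · intro c hc
      by_cases h1 : c + 1 ≤ a
      · have h2 : c ≤ a := by omega
        simpa only [h1, h2, if_true] using hr.share c (by omega)
      · by_cases h2 : c ≤ a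
        · obtain rfl : c = a := by omega
          have h3 : c + 1 + (b - c - 1) = b := by omega
          simpa only [h1, le_refl, h3, if_true, if_false] using hs
        · have h3 : c + 1 + (b - a - 1) = c + (b - a - 1) + 1 := by omega
          simpa only [h1, h2, h3, if_false] using hr.share (c + (b - a - 1)) (by omega)

theorem InducedChain.eq_of_freeReach {α : Type*} {H : α → α → Prop} {T : Set α} {i j : α}
    {m : ℕ} {r : ℕ → α} (h : InducedChain H T i j m r) {a b : ℕ} (ha : a ≤ m) (hb : b ≤ m)
    (hab : FreeReach H T (r b) (r a)) : b = a := by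
  obtain _ | a := a
  · exact h.eq_zero b hb (hab.trans h.start)
  · obtain ⟨d, hd, h1, h2⟩ := h.share a (by omega)
    rcases lt_trichotomy b (a + 1) with hlt | rfl | hlt
    · rcases ha.eq_or_lt with rfl | ha'
      · exact h.eq_last b hb (hab.trans h.finish)
      · obtain ⟨e, he, h3, h4⟩ := h.share (a + 1) ha'
        have := h.succ_of_share b (a + 2) (by omega) (by omega) ⟨e, he, hab.trans h3, h4⟩
        omega
    · rfl
    · exact h.succ_of_share a b (by omega) hb ⟨d, hd, h1, hab.trans h2⟩

/-! ### Labels of nodes by the sources reaching them -/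

/-- The `a`-th source freely reaches `k`. -/
def Label {α : Type*} (H : α → α → Prop) (T : Set α) (m : ℕ) (r : ℕ → α) (k : α) (a : ℕ) :
    Prop :=
  a ≤ m ∧ FreeReach H T (r a) k

/-- The `a`-th source is the only one reaching `k`. -/
def OneLabel {α : Type*} (H : α → α → Prop) (T : Set α) (m : ℕ) (r : ℕ → α) (k : α) (a : ℕ) :
    Prop :=
  Label H T m r k a ∧ ∀ b, Label H T m r k b → b = a

/-- Exactly the two distinct sources `a` and `b` reach `k`. -/
def TwoLabels {α : Type*} (H : α → α → Prop) (T : Set α) (m : ℕ) (r : ℕ → α) (k : α)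
    (a b : ℕ) : Prop :=
  a ≠ b ∧ Label H T m r k a ∧ Label H T m r k b ∧ ∀ c, Label H T m r k c → c = a ∨ c = b

/-- The value that the unobserved parents of a non-source node `k` force on it. -/
def Forced {α : Type*} (H : α → α → Prop) (T : Set α) (m : ℕ) (r : ℕ → α) (k : α)
    (x : α → Bool) : Prop :=
  (k ∉ T ∧ (∃ a, OneLabel H T m r k a) ∧
    ∃ u, H u k ∧ u ∉ T ∧ (∃ a, Label H T m r u a) ∧ x u = true) ∨
  ((∃ a b, TwoLabels H T m r k a b) ∧
    ((∃ u, H u k ∧ u ∉ T ∧ (∃ a b, TwoLabels H T m r u a b) ∧ x u = true) ∨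
      ∃ u v, H u k ∧ u ∉ T ∧ H v k ∧ v ∉ T ∧ (∃ a, OneLabel H T m r u a) ∧
        (∃ a, OneLabel H T m r v a) ∧ x u ≠ x v))

section Labels

variable {α : Type*} {H : α → α → Prop} {T : Set α} {i j : α} {m : ℕ} {r : ℕ → α}

theorem Label.of_parent {u k : α} {a : ℕ} (h : Label H T m r u a) (huk : H u k) (hu : u ∉ T) :
    Label H T m r k a :=
  ⟨h.1, h.2.tail ⟨huk, hu⟩⟩

theorem Label.exists_parent {k : α} {a : ℕ} (h : Label H T m r k a) (hk : k ≠ r a) :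
    ∃ u, H u k ∧ u ∉ T ∧ Label H T m r u a := by
  rcases Relation.ReflTransGen.cases_tail h.2 with h' | ⟨u, hu, huk⟩
  · exact absurd h' hk
  · exact ⟨u, huk.1, huk.2, h.1, hu⟩

theorem OneLabel.not_twoLabels {k : α} {a b c : ℕ} (h : OneLabel H T m r k a) :
    ¬ TwoLabels H T m r k b c :=
  fun h' => h'.1 ((h.2 b h'.2.1).trans (h.2 c h'.2.2.1).symm)

/-- An assignment is compatible with the forced values at all non-source nodes. -/
def Compatible (H : α → α → Prop) (T : Set α) (m : ℕ) (r : ℕ → α) (f : α → Bool) : Prop :=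
  ∀ k, (∀ a ≤ m, k ≠ r a) → (f k = true ↔ Forced H T m r k f)

theorem Compatible.eq_source [Finite α] (hH : IsDAG H) {f : α → Bool}
    (hf : Compatible H T m r f) {k : α} {a : ℕ} (hk : OneLabel H T m r k a)
    (hkT : k ∉ T) : f k = f (r a) := by
  induction k using hH.wellFounded.induction with
  | h k ih =>
  by_cases hs : ∀ b ≤ m, k ≠ r b
  · have hp : ∀ u, H u k → u ∉ T → ∀ b, Label H T m r u b → f u = f (r a) := by
      intro u huk hu b hb
      obtain rfl := hk.2 b (hb.of_parent huk hu)
      exact ih u huk ⟨hb, fun c hc' => hk.2 c (hc'.of_parent huk hu)⟩ hu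
    rw [Bool.eq_iff_iff, hf k hs]
    constructor
    · rintro (⟨-, -, u, huk, hu, ⟨b, hb⟩, hfu⟩ | ⟨⟨b, c, h2⟩, -⟩)
      · rwa [← hp u huk hu b hb]
      · exact absurd h2 hk.not_twoLabels
    · intro hfa
      obtain ⟨u, huk, hu, hb⟩ := hk.1.exists_parent (hs a hk.1.1)
      exact .inl ⟨hkT, ⟨a, hk⟩, u, huk, hu, ⟨a, hb⟩, by rw [hp u huk hu a hb, hfa]⟩
  · push Not at hs
    obtain ⟨b, hb, rfl⟩ := hs
    rw [hk.2 b ⟨hb, .refl⟩]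

theorem Compatible.source_eq_source [Finite α] (hH : IsDAG H) (hc : InducedChain H T i j m r)
    {f : α → Bool} (hf : Compatible H T m r f) {k : α} {a b : ℕ}
    (hk : TwoLabels H T m r k a b) (hfk : f k = false) : f (r a) = f (r b) := by
  induction k using hH.wellFounded.induction with
  | h k ih =>
  have hs : ∀ c ≤ m, k ≠ r c := by
    rintro c hcm rfl
    exact hk.1 ((hc.eq_of_freeReach hcm hk.2.1.1 hk.2.1.2).trans
      (hc.eq_of_freeReach hcm hk.2.2.1.1 hk.2.2.1.2).symm)
  have hnot : ¬ Forced H T m r k f := by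
    rw [← hf k hs, hfk]
    simp
  have two : ∀ u, H u k → u ∉ T → Label H T m r u a → Label H T m r u b →
      f (r a) = f (r b) := by
    intro u huk hu ha hb
    have h2 : TwoLabels H T m r u a b :=
      ⟨hk.1, ha, hb, fun c hc' => hk.2.2.2 c (hc'.of_parent huk hu)⟩
    refine ih u huk h2 ?_
    by_contra hfu
    exact hnot (.inr ⟨⟨a, b, hk⟩, .inl ⟨u, huk, hu, ⟨a, b, h2⟩, by simpa using hfu⟩⟩)
  obtain ⟨u, huk, hu, hua⟩ := hk.2.1.exists_parent (hs a hk.2.1.1)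
  obtain ⟨v, hvk, hv, hvb⟩ := hk.2.2.1.exists_parent (hs b hk.2.2.1.1)
  by_cases hub : Label H T m r u b
  · exact two u huk hu hua hub
  by_cases hva : Label H T m r v a
  · exact two v hvk hv hva hvb
  have h1 : OneLabel H T m r u a := ⟨hua, fun c hc' =>
    (hk.2.2.2 c (hc'.of_parent huk hu)).resolve_right fun h => hub (h ▸ hc')⟩
  have h2 : OneLabel H T m r v b := ⟨hvb, fun c hc' =>
    (hk.2.2.2 c (hc'.of_parent hvk hv)).resolve_left fun h => hva (h ▸ hc')⟩
  rw [← hf.eq_source hH h1 hu, ← hf.eq_source hH h2 hv]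
  by_contra hne
  exact hnot (.inr ⟨⟨a, b, hk⟩, .inr ⟨u, v, huk, hu, hvk, hv, ⟨a, h1⟩, ⟨b, h2⟩, hne⟩⟩)

theorem InducedChain.oneLabel_left (hc : InducedChain H T i j m r) : OneLabel H T m r i 0 :=
  ⟨⟨m.zero_le, hc.start⟩, fun b hb => hc.eq_zero b hb.1 hb.2⟩

theorem InducedChain.oneLabel_right (hc : InducedChain H T i j m r) : OneLabel H T m r j m :=
  ⟨⟨le_rfl, hc.finish⟩, fun b hb => hc.eq_last b hb.1 hb.2⟩

theorem InducedChain.exists_twoLabels (hc : InducedChain H T i j m r) {a : ℕ} (ha : a < m) :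
    ∃ d ∈ T, TwoLabels H T m r d a (a + 1) := by
  obtain ⟨d, hd, h1, h2⟩ := hc.share a ha
  refine ⟨d, hd, by omega, ⟨by omega, h1⟩, ⟨by omega, h2⟩, ?_⟩
  intro c hcd
  by_contra! hne
  rcases Nat.lt_or_ge c a with h | h
  · have := hc.succ_of_share c (a + 1) (by omega) (by omega) ⟨d, hd, hcd.2, h2⟩
    omega
  · have := hc.succ_of_share a c (by omega) hcd.1 ⟨d, hd, h1, hcd.2⟩
    omega

theorem Compatible.eq_ends [Finite α] (hH : IsDAG H) (hc : InducedChain H T i j m r)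
    (hi : i ∉ T) (hj : j ∉ T) {f : α → Bool} (hf : Compatible H T m r f)
    (hT : ∀ t ∈ T, f t = false) : f i = f j := by
  rw [hf.eq_source hH hc.oneLabel_left hi, hf.eq_source hH hc.oneLabel_right hj]
  have key : ∀ a ≤ m, f (r 0) = f (r a) := by
    intro a
    induction a with
    | zero => exact fun _ => rfl
    | succ a ih =>
      intro ha
      obtain ⟨d, hd, h2⟩ := hc.exists_twoLabels (a := a) (by omega)
      rw [ih (by omega), hf.source_eq_source hH hc h2 (hT d hd)]
  exact key m le_rfl

theorem compatible_false : Compatible H T m r fun _ => false := by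
  intro k _
  simp [Forced]

/-- The assignment that is true exactly at the unobserved nodes reached by one source. -/
theorem exists_compatible_true (hc : InducedChain H T i j m r) (hi : i ∉ T) (hj : j ∉ T) :
    ∃ f, Compatible H T m r f ∧ f i = true ∧ f j = true ∧ ∀ t ∈ T, f t = false := by
  classical
  refine ⟨fun k => decide (k ∉ T ∧ ∃ a, OneLabel H T m r k a), ?_, ?_, ?_, ?_⟩
  · intro k hs
    simp only [decide_eq_true_eq]
    constructor
    · rintro ⟨hk, a, ha⟩
      obtain ⟨u, huk, hu, hua⟩ := ha.1.exists_parent (hs a ha.1.1)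
      refine .inl ⟨hk, ⟨a, ha⟩, u, huk, hu, ⟨a, hua⟩, ?_⟩
      simp only [decide_eq_true_eq]
      exact ⟨hu, a, hua, fun c hc' => ha.2 c (hc'.of_parent huk hu)⟩
    · rintro (⟨hk, ha, -⟩ | ⟨-, ⟨u, -, -, ⟨a, b, h2⟩, hu⟩ | ⟨u, v, -, hu, -, hv, h1, h2, hne⟩⟩)
      · exact ⟨hk, ha⟩
      · simp only [decide_eq_true_eq] at hu
        obtain ⟨-, c, h1⟩ := hu
        exact absurd h2 h1.not_twoLabels
      · exact absurd (by simp [hu, hv, h1, h2]) hne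
  · simpa using ⟨hi, _, hc.oneLabel_left⟩
  · simpa using ⟨hj, _, hc.oneLabel_right⟩
  · intro t ht
    simp [ht]

end Labels

/-! ### Binary Bayesian networks -/

/-- The assignment `f` restricted to the parents of `k`. -/
noncomputable def mask {α : Type*} (H : α → α → Prop) (k : α) (f : α → Bool) : α → Bool :=
  fun u => if H u k then f u else false

/-- The conditional probability of the value `f k` of `k` given the values of its parents,
where `θ (k, x)` is the probability of `true` if the parents take the values `x`. -/
noncomputable def kernel {α R : Type*} [CommRing R] (H : α → α → Prop)
    (θ : α × (α → Bool) → R) (k : α) (f : α → Bool) : R :=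
  if f k = true then θ (k, mask H k f) else 1 - θ (k, mask H k f)

/-- The joint distribution of the binary Bayesian network with parameters `θ`. -/
noncomputable def bayes {α R : Type*} [Fintype α] [CommRing R] (H : α → α → Prop)
    (θ : α × (α → Bool) → R) (f : α → Bool) : R :=
  ∏ k, kernel H θ k f

/-- Marginals of binary distributions with values in a commutative ring. -/
noncomputable def ringMargin {α R : Type*} [Fintype α] [DecidableEq α] [CommRing R]
    (p : (α → Bool) → R) (X : Set α) (a : α → Bool) : R :=
  ∑ f, Set.indicator {f | ∀ v ∈ X, f v = a v} p f

theorem margin_eq_ringMargin {α : Type*} [Fintype α] [DecidableEq α]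
    (p : (α → Bool) → ℝ) (X : Set α) (a : α → Bool) : margin p X a = ringMargin p X a := by
  refine Finset.sum_congr rfl fun f _ => ?_
  rw [Set.indicator_apply]
  congr

theorem kernel_congr {α R : Type*} [CommRing R] {H : α → α → Prop}
    (θ : α × (α → Bool) → R) {k : α} {f g : α → Bool} (hk : f k = g k)
    (h : ∀ u, H u k → f u = g u) : kernel H θ k f = kernel H θ k g := by
  have : mask H k f = mask H k g := by
    funext u
    by_cases hu : H u k
    · simp [mask, hu, h u hu]
    · simp [mask, hu]
  rw [kernel, kernel, this, hk]

theorem margin_bayes_half_of_source {α : Type*} [Fintype α] [DecidableEq α]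
    {H : α → α → Prop} (hH : IsDAG H) {θ θ' : α × (α → Bool) → ℝ} {s : α} {X : Set α}
    (hs : s ∉ X) (hθ : ∀ k f g, k ≠ s → (∀ u ≠ s, f u = g u) →
      kernel H θ k f = kernel H θ k g) (hne : ∀ k x, k ≠ s → θ' (k, x) = θ (k, x))
    (hhalf : ∀ x, θ' (s, x) = 1 / 2) (a : α → Bool) :
    margin (bayes H θ) X a = margin (bayes H θ') X a := by
  set flip : (α → Bool) → (α → Bool) := fun f => Function.update f s (!f s) with hflip
  have hinv : Function.Involutive flip := by
    intro f
    simp [hflip]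
  have double : ∀ F : (α → Bool) → ℝ, 2 * ∑ f, F f = ∑ f, (F f + F (flip f)) := by
    intro F
    have := Equiv.sum_comp hinv.toPerm F
    rw [Finset.sum_add_distrib, two_mul]
    congr 1
    exact this.symm
  refine mul_left_cancel₀ (two_ne_zero (α := ℝ)) ?_
  unfold margin
  rw [double, double]
  refine Finset.sum_congr rfl fun f _ => ?_
  have hfl : ∀ u ≠ s, flip f u = f u := fun u hu => by simp [hflip, hu]
  have hiff : (∀ v ∈ X, flip f v = a v) ↔ ∀ v ∈ X, f v = a v := by
    refine forall₂_congr fun v hv => ?_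
    rw [hfl v (fun h => hs (h ▸ hv))]
  simp only [hiff]
  split_ifs
  · have hK' : ∀ k g, k ≠ s → kernel H θ' k g = kernel H θ k g := fun k g hk => by
      simp [kernel, hne k _ hk]
    have hKs : ∀ g, kernel H θ' s g = 1 / 2 := fun g => by
      simp only [kernel, hhalf]
      split_ifs <;> norm_num
    have hmask : mask H s (flip f) = mask H s f := by
      funext u
      by_cases hu : u = s
      · subst hu
        have hnot : ¬ H u u := fun h => hH u (.single h)
        simp [mask, hnot]
      · simp [mask, hfl u hu]
    have hsum : kernel H θ s f + kernel H θ s (flip f) = 1 := by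
      simp only [kernel, hmask]
      cases hfs : f s <;> simp [hflip, hfs]
    have h1 : ∀ g, bayes H θ g =
        kernel H θ s g * ∏ k ∈ Finset.univ.erase s, kernel H θ k g := fun g =>
      (Finset.mul_prod_erase _ _ (Finset.mem_univ s)).symm
    have h2 : ∀ g, bayes H θ' g =
        1 / 2 * ∏ k ∈ Finset.univ.erase s, kernel H θ k g := fun g => by
      rw [← hKs g, bayes, ← Finset.mul_prod_erase _ _ (Finset.mem_univ s)]
      congr 1
      exact Finset.prod_congr rfl fun k hk => hK' k g (Finset.ne_of_mem_erase hk)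
    have h3 : ∏ k ∈ Finset.univ.erase s, kernel H θ k (flip f) =
        ∏ k ∈ Finset.univ.erase s, kernel H θ k f :=
      Finset.prod_congr rfl fun k hk => hθ k _ _ (Finset.ne_of_mem_erase hk) hfl
    rw [h1, h1, h2, h2, h3, ← add_mul, ← add_mul, hsum]
    norm_num
  · rfl

/-- Marginals do not depend on the parameters of a descendant-closed set of nodes that is
marginalized out. -/
theorem margin_bayes_half {α : Type*} [Fintype α] [DecidableEq α] {H : α → α → Prop}
    (hH : IsDAG H) (θ : α × (α → Bool) → ℝ) {X : Set α} (a : α → Bool) (n : ℕ) :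
    ∀ U : Finset α, U.card = n → (∀ k ∈ U, ∀ l, H k l → l ∈ U) → (∀ k ∈ U, k ∉ X) →
      margin (bayes H θ) X a = margin (bayes H fun c => if c.1 ∈ U then 1 / 2 else θ c) X a := by
  induction n with
  | zero =>
    intro U hU _ _
    obtain rfl := Finset.card_eq_zero.1 hU
    simp
  | succ n ih =>
    intro U hU hcl hX
    have hne : (U : Set α).Nonempty := Finset.card_pos.1 (by omega)
    obtain ⟨s, hs, hmin⟩ := hH.wellFounded.has_min _ hne
    rw [ih (U.erase s) (by rw [Finset.card_erase_of_mem hs, hU]; rfl) ?_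
      fun k hk => hX k (Finset.mem_of_mem_erase hk)]
    · refine margin_bayes_half_of_source hH (hX s hs) ?_ ?_ ?_ a
      · intro k f g hk hfg
        by_cases hkU : k ∈ U
        · have hk' : k ∈ U.erase s := Finset.mem_erase.2 ⟨hk, hkU⟩
          simp only [kernel, hk', if_true, hfg k hk]
        · exact kernel_congr _ (hfg k hk) fun u hu =>
            hfg u fun h => hkU (hcl s hs k (h ▸ hu))
      · intro k x hk
        simp [hk]
      · intro x
        simp only [if_pos (Finset.mem_coe.1 hs)]
    · intro k hk l hkl
      refine Finset.mem_erase.2 ⟨?_, hcl k (Finset.mem_of_mem_erase hk) l hkl⟩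
      rintro rfl
      exact hmin k (Finset.mem_of_mem_erase hk) hkl

theorem sum_bayes {α : Type*} [Fintype α] [DecidableEq α] {H : α → α → Prop}
    (hH : IsDAG H) (θ : α × (α → Bool) → ℝ) : ∑ f, bayes H θ f = 1 := by
  have := margin_bayes_half hH θ (X := ∅) (fun _ => false) _ Finset.univ rfl
    (fun _ _ _ _ => Finset.mem_univ _) fun _ _ => Set.notMem_empty _
  have hhalf : (1 : ℝ) - 2⁻¹ = 2⁻¹ := by norm_num
  simpa [margin, bayes, kernel, hhalf] using this

/-- The global Markov property for pairs of single nodes. -/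
theorem condIndep_bayes {α : Type*} [Fintype α] [DecidableEq α] {H : α → α → Prop}
    (hH : IsDAG H) (θ : α × (α → Bool) → ℝ) {i j : α} {T : Set α} (h : ¬ Joined H T i j) :
    CondIndep (bayes H θ) {i} {j} T := by
  intro a _
  set U : Finset α := Finset.univ.filter
    fun k => ¬ ∃ d, (d ∈ T ∨ d = i ∨ d = j) ∧ Relation.ReflTransGen H k d with hU
  have hcl : ∀ k ∈ U, ∀ l, H k l → l ∈ U := by
    intro k hk l hkl
    simp only [hU, Finset.mem_filter, Finset.mem_univ, true_and] at hk ⊢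
    rintro ⟨d, hd, hld⟩
    exact hk ⟨d, hd, .head hkl hld⟩
  have hX : ∀ X : Set α, X ⊆ {i} ∪ {j} ∪ T → ∀ k ∈ U, k ∉ X := by
    intro X hXs k hk hkX
    simp only [hU, Finset.mem_filter, Finset.mem_univ, true_and] at hk
    refine hk ⟨k, ?_, .refl⟩
    rcases hXs hkX with (h | h) | h
    exacts [.inr (.inl h), .inr (.inr h), .inl h]
  rw [margin_bayes_half hH θ a _ U rfl hcl (hX ({i} ∪ {j} ∪ T) subset_rfl),
    margin_bayes_half hH θ a _ U rfl hcl (hX T Set.subset_union_right),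
    margin_bayes_half hH θ a _ U rfl hcl
      (hX ({i} ∪ T) (Set.union_subset_union_left _ Set.subset_union_left)),
    margin_bayes_half hH θ a _ U rfl hcl
      (hX ({j} ∪ T) (Set.union_subset_union_left _ Set.subset_union_right))]
  set θ' : α × (α → Bool) → ℝ := fun c => if c.1 ∈ U then 1 / 2 else θ c with hθ'
  have hi : Linked H T i i := ⟨i, .refl, .refl⟩
  have hj : ¬ Linked H T i j := fun hj => h ⟨j, hj, .refl⟩
  -- Families outside `U` do not mix linked and unlinked unobserved nodes.
  have hfree : ∀ k, k ∉ U → ∃ d, (d ∈ T ∨ d = i ∨ d = j) ∧ FreeReach H T k d := by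
    intro k hk
    simp only [hU, Finset.mem_filter, Finset.mem_univ, true_and, not_not] at hk
    obtain ⟨d, hd, hkd⟩ := hk
    rcases Relation.reflTransGen_iff_eq_or_transGen.1 hkd with rfl | hkd'
    · exact ⟨d, hd, .refl⟩
    · clear hkd
      induction hkd' using Relation.TransGen.head_induction_on with
      | @single c hcd =>
        by_cases hc : c ∈ T
        · exact ⟨c, .inl hc, .refl⟩
        · exact ⟨d, hd, .single ⟨hcd, hc⟩⟩
      | @head c c' hcc' _ ih =>
        by_cases hc : c ∈ T
        · exact ⟨c, .inl hc, .refl⟩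
        · obtain ⟨e, he, h'⟩ := ih
          exact ⟨e, he, .head ⟨hcc', hc⟩ h'⟩
  have hfam : ∀ k, k ∉ U → ∀ u v, FreeReach H T u k → FreeReach H T v k →
      Linked H T i u → Linked H T i v := by
    intro k hk u v hu hv hl
    obtain ⟨d, hd | rfl | rfl, hkd⟩ := hfree k hk
    · exact hl.share ⟨d, hd, hu.trans hkd, hv.trans hkd⟩
    · exact hi.freeReach (hv.trans hkd)
    · exact absurd ⟨u, hl, hu.trans hkd⟩ h
  set swap : (α → Bool) × (α → Bool) → (α → Bool) × (α → Bool) := fun c =>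
    (fun k => if Linked H T i k then c.1 k else c.2 k,
      fun k => if Linked H T i k then c.2 k else c.1 k) with hswap
  have hinv : Function.Involutive swap := by
    rintro ⟨f, g⟩
    refine Prod.ext ?_ ?_ <;> funext k <;> by_cases hk : Linked H T i k <;> simp [hswap, hk]
  have hprod : ∀ f g : α → Bool, (∀ t ∈ T, f t = g t) →
      bayes H θ' f * bayes H θ' g =
        bayes H θ' (swap (f, g)).1 * bayes H θ' (swap (f, g)).2 := by
    intro f g hfg
    rw [bayes, bayes, bayes, bayes, ← Finset.prod_mul_distrib, ← Finset.prod_mul_distrib]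
    refine Finset.prod_congr rfl fun k _ => ?_
    by_cases hk : k ∈ U
    · have hhalf : ∀ f, kernel H θ' k f = 1 / 2 := fun f => by
        simp only [kernel, hθ', hk, if_true]
        split_ifs <;> norm_num
      simp only [hhalf]
    · have hfamk : ∀ u, u = k ∨ H u k → u ∉ T → FreeReach H T u k := by
        rintro u (rfl | hu) huT
        exacts [.refl, .single ⟨hu, huT⟩]
      by_cases hl : ∃ u, (u = k ∨ H u k) ∧ u ∉ T ∧ Linked H T i u
      · obtain ⟨u, hu, huT, hul⟩ := hl
        have hv : ∀ v, v = k ∨ H v k → (swap (f, g)).1 v = f v ∧ (swap (f, g)).2 v = g v := by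
          intro v hv
          by_cases hvT : v ∈ T
          · simp [hswap, hfg v hvT]
          · have := hfam k hk u v (hfamk u hu huT) (hfamk v hv hvT) hul
            simp [hswap, this]
        rw [kernel_congr θ' (hv k (.inl rfl)).1 fun u hu => (hv u (.inr hu)).1,
          kernel_congr θ' (hv k (.inl rfl)).2 fun u hu => (hv u (.inr hu)).2]
      · have hv : ∀ v, v = k ∨ H v k → (swap (f, g)).1 v = g v ∧ (swap (f, g)).2 v = f v := by
          intro v hv
          by_cases hvT : v ∈ T
          · simp [hswap, hfg v hvT]
          · have : ¬ Linked H T i v := fun h' => hl ⟨v, hv, hvT, h'⟩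
            simp [hswap, this]
        rw [kernel_congr θ' (hv k (.inl rfl)).1 fun u hu => (hv u (.inr hu)).1,
          kernel_congr θ' (hv k (.inl rfl)).2 fun u hu => (hv u (.inr hu)).2, mul_comm]
  have hT : ∀ t ∈ T, ∀ c, c.1 t = c.2 t → (swap c).1 t = c.1 t ∧ (swap c).2 t = c.1 t := by
    intro t _ c hc
    simp [hswap, hc]
  simp only [margin_eq_ringMargin, ringMargin]
  rw [Fintype.sum_mul_sum, Fintype.sum_mul_sum, ← Fintype.sum_prod_type',
    ← Fintype.sum_prod_type', ← Equiv.sum_comp hinv.toPerm]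
  refine Finset.sum_congr rfl fun c _ => ?_
  obtain ⟨f, g⟩ := c
  simp only [Function.Involutive.coe_toPerm]
  have hmem : ((swap (f, g)).1 ∈ {f | ∀ v ∈ {i} ∪ {j} ∪ T, f v = a v} ∧
        (swap (f, g)).2 ∈ {f | ∀ v ∈ T, f v = a v}) ↔
      f ∈ {f | ∀ v ∈ {i} ∪ T, f v = a v} ∧ g ∈ {f | ∀ v ∈ {j} ∪ T, f v = a v} := by
    have hi1 : (swap (f, g)).1 i = f i := by simp [hswap, hi]
    have hj1 : (swap (f, g)).1 j = g j := by simp [hswap, hj]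
    constructor
    · rintro ⟨h1, h2⟩
      have h3 : ∀ t ∈ T, f t = a t ∧ g t = a t := by
        intro t ht
        have := hT t ht (swap (f, g)) ((h1 t (.inr ht)).trans (h2 t ht).symm)
        rw [hinv] at this
        exact ⟨this.1.trans (h1 t (.inr ht)), this.2.trans (h1 t (.inr ht))⟩
      constructor
      · rintro v (rfl | hv)
        exacts [hi1.symm.trans (h1 v (by simp)), (h3 v hv).1]
      · rintro v (rfl | hv)
        exacts [hj1.symm.trans (h1 v (by simp)), (h3 v hv).2]
    · rintro ⟨h1, h2⟩
      have h3 : ∀ t ∈ T, (swap (f, g)).1 t = a t ∧ (swap (f, g)).2 t = a t := by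
        intro t ht
        have h4 := h1 t (.inr ht)
        have := hT t ht (f, g) (h4.trans (h2 t (.inr ht)).symm)
        exact ⟨this.1.trans h4, this.2.trans h4⟩
      refine ⟨?_, fun t ht => (h3 t ht).2⟩
      rintro v ((rfl | rfl) | hv)
      exacts [hi1.trans (h1 v (by simp)), hj1.trans (h2 v (by simp)), (h3 v hv).1]
  by_cases hfg : f ∈ {f | ∀ v ∈ {i} ∪ T, f v = a v} ∧ g ∈ {f | ∀ v ∈ {j} ∪ T, f v = a v}
  · rw [Set.indicator_of_mem hfg.1, Set.indicator_of_mem hfg.2,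
      Set.indicator_of_mem (hmem.2 hfg).1, Set.indicator_of_mem (hmem.2 hfg).2]
    exact (hprod f g fun t ht => (hfg.1 t (.inr ht)).trans (hfg.2 t (.inr ht)).symm).symm
  · have mul_zero' : ∀ {A B : Set (α → Bool)} {f g : α → Bool}, ¬ (f ∈ A ∧ g ∈ B) →
        A.indicator (bayes H θ') f * B.indicator (bayes H θ') g = 0 := by
      intro A B f g hAB
      rcases not_and_or.1 hAB with hA | hB
      · rw [Set.indicator_of_notMem hA, zero_mul]
      · rw [Set.indicator_of_notMem hB, mul_zero]
    rw [mul_zero' hfg, mul_zero' (hmem.not.2 hfg)]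

/-! ### A network witnessing a conditional dependence -/

theorem Forced.congr {α : Type*} {H : α → α → Prop} {T : Set α} {m : ℕ} {r : ℕ → α} {k : α}
    {x y : α → Bool} (hx : Forced H T m r k x) (h : ∀ u, H u k → x u = y u) :
    Forced H T m r k y := by
  rcases hx with ⟨hk, h1, u, hu, huT, hl, hxu⟩ |
    ⟨h2, ⟨u, hu, huT, hl, hxu⟩ | ⟨u, v, hu, huT, hv, hvT, hul, hvl, hne⟩⟩
  · exact .inl ⟨hk, h1, u, hu, huT, hl, (h u hu).symm.trans hxu⟩
  · exact .inr ⟨h2, .inl ⟨u, hu, huT, hl, (h u hu).symm.trans hxu⟩⟩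
  · exact .inr ⟨h2, .inr ⟨u, v, hu, huT, hv, hvT, hul, hvl, by rwa [← h u hu, ← h v hv]⟩⟩

/-- The parameters of a network in which the sources `r 0, …, r m` are fair coins and every
other node takes its forced value. -/
noncomputable def forcedParams {α : Type*} (H : α → α → Prop) (T : Set α) (m : ℕ)
    (r : ℕ → α) : α × (α → Bool) → ℝ :=
  fun c => if ∃ a ≤ m, c.1 = r a then 1 / 2 else if Forced H T m r c.1 c.2 then 1 else 0

theorem kernel_forcedParams {α : Type*} (H : α → α → Prop) (T : Set α) (m : ℕ) (r : ℕ → α)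
    (k : α) (f : α → Bool) : kernel H (forcedParams H T m r) k f =
      if ∃ a ≤ m, k = r a then 1 / 2
      else if f k = true ↔ Forced H T m r k f then 1 else 0 := by
  have hF : Forced H T m r k (mask H k f) ↔ Forced H T m r k f :=
    ⟨fun h => h.congr fun u hu => by simp [mask, hu],
      fun h => h.congr fun u hu => by simp [mask, hu]⟩
  simp only [kernel, forcedParams, hF]
  by_cases hs : ∃ a ≤ m, k = r a
  · simp only [hs, if_true]
    split_ifs <;> norm_num
  · simp only [hs, if_false]
    by_cases h1 : f k = true <;> by_cases h2 : Forced H T m r k f <;> simp [h1, h2]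

theorem bayes_forcedParams_nonneg {α : Type*} [Fintype α] (H : α → α → Prop) (T : Set α)
    (m : ℕ) (r : ℕ → α) (f : α → Bool) : 0 ≤ bayes H (forcedParams H T m r) f := by
  refine Finset.prod_nonneg fun k _ => ?_
  rw [kernel_forcedParams]
  split_ifs <;> norm_num

theorem bayes_forcedParams_ne_zero {α : Type*} [Fintype α] {H : α → α → Prop} {T : Set α}
    {m : ℕ} {r : ℕ → α} {f : α → Bool} :
    bayes H (forcedParams H T m r) f ≠ 0 ↔ Compatible H T m r f := by
  rw [bayes, Finset.prod_ne_zero_iff]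
  refine forall_congr' fun k => ?_
  rw [kernel_forcedParams]
  by_cases hs : ∃ a ≤ m, k = r a
  · simp only [hs, if_true]
    obtain ⟨a, ha, rfl⟩ := hs
    simp only [Finset.mem_univ, forall_const]
    exact ⟨fun _ h => absurd rfl (h a ha), fun _ => by norm_num⟩
  · have hs' : ∀ a ≤ m, k ≠ r a := fun a ha h => hs ⟨a, ha, h⟩
    simp only [hs, if_false, Finset.mem_univ, forall_const, ne_eq, ite_eq_right_iff, one_ne_zero,
      imp_false, not_not]
    exact ⟨fun h _ => h, fun h => h hs'⟩

theorem margin_pos {α : Type*} [Fintype α] [DecidableEq α] {p : (α → Bool) → ℝ}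
    (hp : ∀ f, 0 ≤ p f) {X : Set α} {a f : α → Bool} (hf : 0 < p f) (ha : ∀ v ∈ X, f v = a v) :
    0 < margin p X a := by
  refine Finset.sum_pos' (fun g _ => ?_) ⟨f, Finset.mem_univ f, by rwa [if_pos ha]⟩
  split_ifs
  exacts [hp g, le_rfl]

/-- The difference of the two sides of the conditional independence of `i` and `j` given `T`,
at an assignment separating `i` from the other nodes. -/
noncomputable def defect {α R : Type*} [Fintype α] [DecidableEq α] [CommRing R]
    (p : (α → Bool) → R) (i j : α) (T : Set α) : R :=
  let a := fun k => decide (k = i)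
  ringMargin p ({i} ∪ {j} ∪ T) a * ringMargin p T a -
    ringMargin p ({i} ∪ T) a * ringMargin p ({j} ∪ T) a

theorem defect_eq {α : Type*} [Fintype α] [DecidableEq α] (p : (α → Bool) → ℝ) (i j : α)
    (T : Set α) : defect p i j T =
      margin p ({i} ∪ {j} ∪ T) (fun k => decide (k = i)) * margin p T (fun k => decide (k = i)) -
        margin p ({i} ∪ T) (fun k => decide (k = i)) *
          margin p ({j} ∪ T) (fun k => decide (k = i)) := by
  simp only [margin_eq_ringMargin]
  rfl

theorem Joined.exists_defect_ne_zero {α : Type*} [Fintype α] [DecidableEq α] {H : α → α → Prop}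
    (hH : IsDAG H) {T : Set α} {i j : α} (hij : i ≠ j) (hi : i ∉ T) (hj : j ∉ T)
    (h : Joined H T i j) : ∃ θ : α × (α → Bool) → ℝ, defect (bayes H θ) i j T ≠ 0 := by
  obtain ⟨m, r, hc⟩ := h.exists_inducedChain
  refine ⟨forcedParams H T m r, ?_⟩
  set a : α → Bool := fun k => decide (k = i) with ha
  have hai : a i = true := by simp [ha]
  have haj : a j = false := by simp [ha, hij.symm]
  have haT : ∀ t ∈ T, a t = false := fun t ht => by
    simpa [ha] using fun h : t = i => hi (h ▸ ht)
  set p := bayes H (forcedParams H T m r) with hp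
  have hnn : ∀ f, 0 ≤ p f := bayes_forcedParams_nonneg H T m r
  have hpos : ∀ f, Compatible H T m r f → 0 < p f := fun f hf =>
    (hnn f).lt_of_ne' (bayes_forcedParams_ne_zero.2 hf)
  have h0 : margin p ({i} ∪ {j} ∪ T) a = 0 := by
    refine Finset.sum_eq_zero fun f _ => ?_
    split_ifs with hf
    · by_contra hne
      have := (bayes_forcedParams_ne_zero.1 hne).eq_ends hH hc hi hj fun t ht =>
        (hf t (.inr ht)).trans (haT t ht)
      rw [hf i (by simp), hf j (by simp), hai, haj] at this
      exact absurd this (by simp)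
    · rfl
  have h1 : 0 < margin p ({i} ∪ T) a := by
    obtain ⟨f, hf, hfi, -, hfT⟩ := exists_compatible_true hc hi hj
    refine margin_pos hnn (hpos f hf) ?_
    rintro v (rfl | hv)
    exacts [hfi.trans hai.symm, (hfT v hv).trans (haT v hv).symm]
  have h2 : 0 < margin p ({j} ∪ T) a := by
    refine margin_pos hnn (hpos _ compatible_false) ?_
    rintro v (rfl | hv)
    exacts [haj.symm, (haT v hv).symm]
  rw [defect_eq, h0, zero_mul, zero_sub]
  exact (neg_neg_of_pos (mul_pos h1 h2)).ne

/-! ### Faithful networks -/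

theorem map_defect_bayes {α R R' : Type*} [Fintype α] [DecidableEq α] [CommRing R] [CommRing R']
    (φ : R →+* R') (H : α → α → Prop) (θ : α × (α → Bool) → R) (i j : α) (T : Set α) :
    φ (defect (bayes H θ) i j T) = defect (bayes H (φ ∘ θ)) i j T := by
  have hb : ∀ f, φ (bayes H θ f) = bayes H (φ ∘ θ) f := fun f => by
    rw [bayes, bayes, map_prod]
    refine Finset.prod_congr rfl fun k _ => ?_
    rw [kernel, kernel, apply_ite φ, map_sub, map_one]
    rfl
  have hm : ∀ X a, φ (ringMargin (bayes H θ) X a) = ringMargin (bayes H (φ ∘ θ)) X a :=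
    fun X a => by
      rw [ringMargin, ringMargin, map_sum]
      refine Finset.sum_congr rfl fun f _ => ?_
      rw [Set.indicator_apply, Set.indicator_apply, apply_ite φ, map_zero, hb]
  simp only [defect, map_sub, map_mul, hm]

theorem exists_generic {σ ι : Type*} [Finite σ] [Finite ι] (P : ι → MvPolynomial σ ℝ)
    (hP : ∀ k, P k ≠ 0) : ∃ θ : σ → ℝ, (∀ c, θ c ∈ Set.Ioo (0 : ℝ) 1) ∧
      ∀ k, MvPolynomial.eval θ (P k) ≠ 0 := by
  have := Fintype.ofFinite ι
  by_contra! h0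
  refine Finset.prod_ne_zero_iff.2 (fun k _ => hP k) (MvPolynomial.funext_set
    (p := ∏ k, P k) (q := 0) (fun _ => Set.Ioo (0 : ℝ) 1) (fun _ => Set.Ioo_infinite one_pos)
    fun θ hθ => ?_)
  obtain ⟨k, hk⟩ := h0 θ fun c => hθ c (Set.mem_univ c)
  rw [map_prod, map_zero, Finset.prod_eq_zero (Finset.mem_univ k) hk]

/-- Every finite DAG has a positive binary distribution that is faithful to it for pairs of
single nodes. -/
theorem IsDAG.exists_faithful_pairs {α : Type*} [Fintype α] [DecidableEq α]
    {H : α → α → Prop} (hH : IsDAG H) : ∃ p : (α → Bool) → ℝ, IsDist p ∧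
      ∀ i j : α, i ≠ j → ∀ T : Set α, i ∉ T → j ∉ T →
        (CondIndep p {i} {j} T ↔ DSep H T i j) := by
  have heval : ∀ (θ : α × (α → Bool) → ℝ) i j T,
      MvPolynomial.eval θ (defect (bayes H MvPolynomial.X) i j T) =
        defect (bayes H θ) i j T := by
    intro θ i j T
    rw [map_defect_bayes]
    congr 2
    funext c
    simp
  obtain ⟨θ, hθ, hne⟩ := exists_generic
    (fun s : {s : α × α × Set α // s.1 ≠ s.2.1 ∧ s.1 ∉ s.2.2 ∧ s.2.1 ∉ s.2.2 ∧
      Joined H s.2.2 s.1 s.2.1} => defect (bayes H MvPolynomial.X) s.1.1 s.1.2.1 s.1.2.2) (by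
    rintro ⟨⟨i, j, T⟩, hij, hi, hj, h⟩ h0
    obtain ⟨θ, hθ⟩ := h.exists_defect_ne_zero hH hij hi hj
    exact hθ (by rw [← heval, h0, map_zero]))
  have hpos : ∀ f, 0 < bayes H θ f := fun f => Finset.prod_pos fun k _ => by
    rw [kernel]
    split_ifs
    · exact (hθ _).1
    · exact sub_pos.2 (hθ _).2
  refine ⟨bayes H θ, ⟨fun f => (hpos f).le, sum_bayes hH θ⟩, fun i j hij T hi hj => ?_⟩
  rw [dSep_iff_not_joined hH hij hi hj]
  refine ⟨fun hci h => hne ⟨(i, j, T), hij, hi, hj, h⟩ ?_, condIndep_bayes hH θ⟩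
  rw [heval, defect_eq]
  exact sub_eq_zero.2 (hci _ (margin_pos (fun f => (hpos f).le) (hpos _) fun _ _ => rfl))

/-! ### Copying the variables of a distribution -/

/-- The distribution on `V` in which `v` is a copy of the variable `π v` of `p`. -/
noncomputable def copies {V I : Type*} [Fintype I] [DecidableEq I] (π : V → I)
    (p : (I → Bool) → ℝ) (f : V → Bool) : ℝ :=
  ∑ g : I → Bool, if f = g ∘ π then p g else 0

section Copies

variable {V I : Type*} [Fintype V] [DecidableEq V] [Fintype I] [DecidableEq I]
  (π : V → I) (p : (I → Bool) → ℝ)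

theorem sum_indicator_copies (F : Set (V → Bool)) :
    ∑ f, F.indicator (copies π p) f = ∑ g, Set.indicator {g | g ∘ π ∈ F} p g := by
  have h : ∀ f, F.indicator (copies π p) f =
      ∑ g : I → Bool, if f = g ∘ π then Set.indicator {g | g ∘ π ∈ F} p g else 0 := by
    intro f
    by_cases hf : f ∈ F
    · rw [Set.indicator_of_mem hf]
      refine Finset.sum_congr rfl fun g _ => ?_
      split_ifs with hfg
      · exact (Set.indicator_of_mem (s := {g | g ∘ π ∈ F}) (show g ∘ π ∈ F from hfg ▸ hf) p).symm
      · rfl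
    · rw [Set.indicator_of_notMem hf]
      refine (Finset.sum_eq_zero fun g _ => ?_).symm
      split_ifs with hfg
      · exact Set.indicator_of_notMem (s := {g | g ∘ π ∈ F}) (show g ∘ π ∉ F from hfg ▸ hf) p
      · rfl
  simp only [h]
  rw [Finset.sum_comm]
  simp

theorem margin_copies (X : Set V) (a : V → Bool) : margin (copies π p) X a =
    ∑ g : I → Bool, Set.indicator {g | ∀ v ∈ X, g (π v) = a v} p g := by
  rw [margin_eq_ringMargin]
  exact sum_indicator_copies π p _

variable {π p}

theorem IsDist.copies (hp : IsDist p) : IsDist (copies π p) := by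
  refine ⟨fun f => Finset.sum_nonneg fun g _ => ?_, ?_⟩
  · split_ifs
    exacts [hp.1 g, le_rfl]
  · simpa [hp.2] using sum_indicator_copies π p Set.univ

theorem margin_copies_congr {X Y : Set V} {a b : V → Bool}
    (h : ∀ g : I → Bool, (∀ v ∈ X, g (π v) = a v) ↔ ∀ v ∈ Y, g (π v) = b v) :
    margin (copies π p) X a = margin (copies π p) Y b := by
  simp only [margin_copies, h]

theorem exists_of_margin_copies_ne_zero {X : Set V} {a : V → Bool}
    (h : margin (copies π p) X a ≠ 0) : ∃ g : I → Bool, ∀ v ∈ X, g (π v) = a v := by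
  by_contra! h0
  refine h ?_
  rw [margin_copies]
  refine Finset.sum_eq_zero fun g _ => Set.indicator_of_notMem ?_ _
  obtain ⟨v, hv, hne⟩ := h0 g
  exact fun hg => hne (hg v hv)

theorem margin_copies_comp (X : Set V) (b : I → Bool) :
    margin (copies π p) X (b ∘ π) = margin p (π '' X) b := by
  rw [margin_copies, margin_eq_ringMargin, ringMargin]
  simp

theorem CondIndep.of_copies {X Y Z : Set V} (h : CondIndep (copies π p) X Y Z) :
    CondIndep p (π '' X) (π '' Y) (π '' Z) := by
  intro b hb
  rw [← margin_copies_comp] at hb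
  simpa only [margin_copies_comp, Set.image_union] using h _ hb

theorem condIndep_copies_preimage (hπ : Function.Surjective π) {X Y Z : Set I} :
    CondIndep (copies π p) (π ⁻¹' X) (π ⁻¹' Y) (π ⁻¹' Z) ↔ CondIndep p X Y Z := by
  constructor
  · intro h
    simpa only [Set.image_preimage_eq _ hπ] using h.of_copies
  · intro h a ha
    by_cases hab : ∃ b : I → Bool, ∀ v ∈ π ⁻¹' X ∪ π ⁻¹' Y ∪ π ⁻¹' Z, b (π v) = a v
    · obtain ⟨b, hb⟩ := hab
      have key : ∀ W ⊆ X ∪ Y ∪ Z, margin (copies π p) (π ⁻¹' W) a = margin p W b := by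
        intro W hW
        rw [← Set.image_preimage_eq W hπ, ← margin_copies_comp, Set.image_preimage_eq W hπ]
        refine margin_copies_congr fun g => forall₂_congr fun v hv => ?_
        rw [← hb v (hW hv), Function.comp_apply]
      simp only [← Set.preimage_union]
      rw [key Z Set.subset_union_right] at ha ⊢
      rw [key _ subset_rfl, key (X ∪ Z) (Set.union_subset_union_left _ Set.subset_union_left),
        key (Y ∪ Z) (Set.union_subset_union_left _ Set.subset_union_right)]
      exact h b ha
    · have h0 : margin (copies π p) (π ⁻¹' X ∪ π ⁻¹' Y ∪ π ⁻¹' Z) a = 0 := by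
        by_contra hne
        exact hab (exists_of_margin_copies_ne_zero hne)
      rw [h0, zero_mul]
      by_contra hne
      obtain ⟨g1, h1⟩ := exists_of_margin_copies_ne_zero (left_ne_zero_of_mul (Ne.symm hne))
      obtain ⟨g2, h2⟩ := exists_of_margin_copies_ne_zero (right_ne_zero_of_mul (Ne.symm hne))
      refine hab ⟨fun k => if k ∈ X ∪ Z then g1 k else g2 k, fun v hv => ?_⟩
      by_cases hvX : π v ∈ X ∪ Z
      · simpa only [hvX, if_true] using h1 v hvX
      · simp only [hvX, if_false]
        refine h2 v ?_
        rcases hv with (hv | hv) | hv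
        exacts [absurd (.inl hv) hvX, .inl hv, .inr hv]

theorem condIndep_copies_of_eq {x y : V} (hxy : π x = π y) (Y : Set V) :
    CondIndep (copies π p) {x} Y {y} := by
  intro a _
  by_cases hax : a x = a y
  · have hg : ∀ g : I → Bool, g (π y) = a y → g (π x) = a x := fun g h => by
      rw [hxy, h, hax]
    rw [margin_copies_congr (X := {x} ∪ Y ∪ {y}) (Y := Y ∪ {y}) (b := a) fun g => ?_,
      margin_copies_congr (X := {x} ∪ {y}) (Y := {y}) (b := a) fun g => ?_, mul_comm]
    · exact ⟨fun h v hv => h v (.inr hv), by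
        rintro h v (rfl | hv)
        exacts [hg g (h y rfl), h v hv]⟩
    · exact ⟨fun h v hv => h v (hv.imp_left .inr), by
        rintro h v ((rfl | hv) | hv)
        exacts [hg g (h y (.inr rfl)), h v (.inl hv), h v (.inr hv)]⟩
  · have h0 : ∀ X : Set V, x ∈ X → y ∈ X → margin (copies π p) X a = 0 := by
      intro X hx hy
      by_contra hne
      obtain ⟨g, hg⟩ := exists_of_margin_copies_ne_zero hne
      exact hax (by rw [← hg x hx, ← hg y hy, hxy])
    rw [h0 ({x} ∪ Y ∪ {y}) (by simp) (by simp), h0 ({x} ∪ {y}) (by simp) (by simp)]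
    simp

end Copies

theorem ActivePath.of_empty {α : Type*} {G : α → α → Prop} {i x c : α} {n : ℕ} {q : ℕ → α}
    (h : ActivePath G ∅ i x n q) (hc : ∀ m ≤ n, q m ≠ c) : ActivePath G {c} i x n q where
  inj := h.inj
  start := h.start
  finish := h.finish
  adj := h.adj
  collider k hk h1 h2 := by simpa [Opened] using h.collider k hk h1 h2
  noncollider k hk _ := hc (k + 1) hk.le

/-- If `x` and `y` are connected without observations, then observing `x'` does not separate `x`
from `y`, or observing `x` does not separate `x'` from `y`. -/
theorem DConn.of_empty {α : Type*} {G : α → α → Prop} {x x' y : α} (hxx' : x ≠ x')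
    (hxy : x ≠ y) (hxy' : x' ≠ y) (h : DConn G ∅ x y) :
    DConn G {x'} x y ∨ DConn G {x} x' y := by
  rw [dConn_iff_activeReach hxy] at h
  rw [dConn_iff_activeReach hxy, dConn_iff_activeReach hxy']
  obtain ⟨n, q, hq⟩ := h.symm
  by_cases hx' : ∃ m ≤ n, q m = x'
  · obtain ⟨m, hm, rfl⟩ := hx'
    refine .inr (ActiveReach.symm ⟨m, q, (hq.truncate hm).of_empty fun l hl hlx => ?_⟩)
    obtain rfl := hq.inj l n (hl.trans hm) le_rfl (hlx.trans hq.finish.symm)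
    obtain rfl : m = l := le_antisymm hm hl
    exact hxx' hlx.symm
  · exact .inl (ActiveReach.symm ⟨n, q, hq.of_empty fun m hm h => hx' ⟨m, hm, h⟩⟩)

theorem DConn.of_adj {α : Type*} {H : α → α → Prop} {T : Set α} {i j : α} (hij : i ≠ j)
    (h : Adj H i j) : DConn H T i j := by
  refine ⟨0, ![i, j], ?_, rfl, rfl, ?_, fun k hk => by omega⟩
  · intro a b
    fin_cases a <;> fin_cases b <;> simp [hij, hij.symm]
  · intro k hk
    obtain rfl : k = 0 := by omega
    exact h

/-- Lemma 11 of the paper. If the maximum group size is 2 and two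
groups of size 2 are adjacent in the group DAG `H`, then there is a binary-valued
distribution that is groupwise faithful to `H` given the grouping but is not
faithful to any DAG on the variables. -/
theorem size_two_adjacent_groupwise_faithful_unfaithful
    {V I : Type*} [Fintype V] [Fintype I] [DecidableEq V]
    (π : V → I) (hπ : Function.Surjective π)
    (H : I → I → Prop) (hH : IsDAG H)
    (hmax : ∀ i : I, (π ⁻¹' {i}).ncard ≤ 2)
    (hadj : ∃ i j : I, i ≠ j ∧ (π ⁻¹' {i}).ncard = 2 ∧ (π ⁻¹' {j}).ncard = 2 ∧
      Adj H i j) :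
    ∃ p : (∀ _ : V, Bool) → ℝ, IsDist p ∧ GroupwiseFaithful p π H ∧
      ∀ G : V → V → Prop, IsDAG G → ¬ Faithful p G := by
  obtain ⟨p, hp, hfaith⟩ := hH.exists_faithful_pairs
  refine ⟨copies π p, hp.copies, fun i j hij T hi hj => ?_, fun G _ hG => ?_⟩
  · rw [condIndep_copies_preimage hπ, hfaith i j hij T hi hj]
  obtain ⟨i, j, hij, hi, -, hadj⟩ := hadj
  obtain ⟨x, x', hxx', hxx⟩ := Set.ncard_eq_two.1 hi
  have hx : π x = i := by
    have : x ∈ π ⁻¹' {i} := by simp [hxx]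
    exact this
  have hx' : π x' = i := by
    have : x' ∈ π ⁻¹' {i} := by simp [hxx]
    exact this
  obtain ⟨y, hy⟩ := hπ j
  have hxy : x ≠ y := fun h => hij (by rw [← hx, h, hy])
  have hxy' : x' ≠ y := fun h => hij (by rw [← hx', h, hy])
  have hsep : ∀ {u v : V} {Z : Set V}, u ≠ v → u ∉ Z → v ∉ Z →
      (CondIndep (copies π p) {u} {v} Z ↔ ¬ DConn G Z u v) := by
    intro u v Z huv hu hv
    rw [hG {u} {v} Z (Set.singleton_nonempty u) (Set.singleton_nonempty v)
      (Set.disjoint_singleton.2 huv) (Set.disjoint_singleton_left.2 hu)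
      (Set.disjoint_singleton_left.2 hv)]
    simp [DSepSet, DSep]
  have hcon : DConn G ∅ x y := by
    by_contra hcon
    have := ((hsep hxy (Set.notMem_empty _) (Set.notMem_empty _)).2 hcon).of_copies
    rw [Set.image_singleton, Set.image_singleton, Set.image_empty, hx, hy,
      hfaith i j hij ∅ (Set.notMem_empty _) (Set.notMem_empty _)] at this
    exact this (.of_adj hij hadj)
  rcases hcon.of_empty hxx' hxy hxy' with h | h
  · exact (hsep hxy (by simpa using hxx') (by simpa using hxy'.symm)).1
      (condIndep_copies_of_eq (hx.trans hx'.symm) _) h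
  · exact (hsep hxy' (by simpa using hxx'.symm) (by simpa using hxy.symm)).1
      (condIndep_copies_of_eq (hx'.trans hx.symm) _) h

end GroupBN
end
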